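/- arXiv:math/0002128 — 2 statements merged into one kernel-verified Lean document; each statement's English description precedes it below -/
import Mathlib

section
/- Let (A,R) be a pseudoinvolutive cotriangular Hopf algebra over k with Drinfeld element u. Then there exists an algebra homomorphism c : A → k (a grouplike element of A*) which is central in the convolution algebra A* and satisfies c∗c = ε, such that, setting R_c(a⊗b) = (1/2)(ε(a)ε(b) + ε(a)c(b) + c(a)ε(b) − c(a)c(b)) and letting u' = u∗c be the Drinfeld element of the cotriangular Hopf algebra (A, R∗R_c), one has tr(u'|_V) = dim V for every finite-dimensional right A-comodule V. -/
open TensorProduct LinearMap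

noncomputable section

universe u
variable {k A : Type u} [Field k] [Ring A] [HopfAlgebra k A]

/-- The convolution product on `Hom_k(A, k)`:  `(f ∗ g)(a) = Σ f(a₁) g(a₂)`. -/
def conv1 (f g : A →ₗ[k] k) : A →ₗ[k] k :=
  mul' k k ∘ₗ map f g ∘ₗ Coalgebra.comul

/-- The convolution product on `Hom_k(A ⊗ A, k)` (using the tensor-product coalgebra
structure of `A ⊗ A`):  `(f ∗ g)(a ⊗ b) = Σ f(a₁ ⊗ b₁) g(a₂ ⊗ b₂)`. -/
def conv2 (f g : A ⊗[k] A →ₗ[k] k) : A ⊗[k] A →ₗ[k] k :=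
  mul' k k ∘ₗ map f g ∘ₗ (Coalgebra.comul : A ⊗[k] A →ₗ[k] (A ⊗[k] A) ⊗[k] (A ⊗[k] A))

/-- The counit of the coalgebra `A ⊗ A`, i.e. `a ⊗ b ↦ ε(a) ε(b)`; this is the unit of the
convolution algebra `(A ⊗ A)*`. -/
def eps2 : A ⊗[k] A →ₗ[k] k := (Coalgebra.counit : A ⊗[k] A →ₗ[k] k)

/-- Coquasitriangularity of a linear form `R : A ⊗ A → k` with respect to a (possibly
twisted) multiplication `m` on the underlying coalgebra of `A` (with the same unit `1`):
`R` is convolution invertible and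
`R(m(a⊗b) ⊗ c) = Σ R(a⊗c₁) R(b⊗c₂)`, `R(a ⊗ m(b⊗c)) = Σ R(a₁⊗c) R(a₂⊗b)`,
`R(a⊗1) = ε(a) = R(1⊗a)`, and `Σ m(b₁⊗a₁) R(a₂⊗b₂) = Σ R(a₁⊗b₁) m(a₂⊗b₂)`. -/
structure IsCQT (m : A ⊗[k] A →ₗ[k] A) (R : A ⊗[k] A →ₗ[k] k) : Prop where
  conv_invertible : ∃ Rinv, conv2 R Rinv = eps2 ∧ conv2 Rinv R = eps2
  mul_left : R ∘ₗ map m LinearMap.id =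
    mul' k k ∘ₗ map R R ∘ₗ (tensorTensorTensorComm k A A A A).toLinearMap ∘ₗ
      map LinearMap.id Coalgebra.comul
  mul_right : R ∘ₗ map LinearMap.id m =
    mul' k k ∘ₗ map R R ∘ₗ (tensorTensorTensorComm k A A A A).toLinearMap ∘ₗ
      map LinearMap.id (TensorProduct.comm k A A).toLinearMap ∘ₗ
      map Coalgebra.comul LinearMap.id
  unit_right : ∀ a : A, R (a ⊗ₜ 1) = Coalgebra.counit a
  unit_left : ∀ a : A, R (1 ⊗ₜ a) = Coalgebra.counit a
  comm_rel : (TensorProduct.rid k A).toLinearMap ∘ₗ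
      map (m ∘ₗ (TensorProduct.comm k A A).toLinearMap) R ∘ₗ
      (Coalgebra.comul : A ⊗[k] A →ₗ[k] (A ⊗[k] A) ⊗[k] (A ⊗[k] A)) =
    (TensorProduct.lid k A).toLinearMap ∘ₗ map R m ∘ₗ
      (Coalgebra.comul : A ⊗[k] A →ₗ[k] (A ⊗[k] A) ⊗[k] (A ⊗[k] A))

/-- Cotriangularity: coquasitriangular, and the convolution inverse of `R` is `R ∘ τ`. -/
structure IsCT (m : A ⊗[k] A →ₗ[k] A) (R : A ⊗[k] A →ₗ[k] k) extends IsCQT m R : Prop where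
  tri_right : conv2 R (R ∘ₗ (TensorProduct.comm k A A).toLinearMap) = eps2
  tri_left : conv2 (R ∘ₗ (TensorProduct.comm k A A).toLinearMap) R = eps2

/-- The Drinfeld element `u ∈ A*`, `u(a) = Σ R(a₂ ⊗ S(a₁))`. -/
def drinfeld (R : A ⊗[k] A →ₗ[k] k) : A →ₗ[k] k :=
  R ∘ₗ map LinearMap.id (HopfAlgebra.antipode (R := k)) ∘ₗ
    (TensorProduct.comm k A A).toLinearMap ∘ₗ Coalgebra.comul

/-- `ρ` makes `V` into a right `A`-comodule:  `(ρ ⊗ id) ∘ ρ = (id ⊗ Δ) ∘ ρ` and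
`(id ⊗ ε) ∘ ρ = id`. -/
structure IsComod (V : Type u) [AddCommGroup V] [Module k V]
    (ρ : V →ₗ[k] V ⊗[k] A) : Prop where
  coassoc : (TensorProduct.assoc k V A A).toLinearMap ∘ₗ map ρ LinearMap.id ∘ₗ ρ =
    map LinearMap.id Coalgebra.comul ∘ₗ ρ
  counit_id : (TensorProduct.rid k V).toLinearMap ∘ₗ map LinearMap.id Coalgebra.counit ∘ₗ ρ =
    LinearMap.id

/-- The endomorphism `f|_V : v ↦ (id ⊗ f)(ρ(v))` of a right `A`-comodule `(V, ρ)` attached to a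
linear form `f ∈ A*`. -/
def coact {V : Type u} [AddCommGroup V] [Module k V] (ρ : V →ₗ[k] V ⊗[k] A)
    (f : A →ₗ[k] k) : V →ₗ[k] V :=
  (TensorProduct.rid k V).toLinearMap ∘ₗ map LinearMap.id f ∘ₗ ρ

/-- Pseudoinvolutivity: `tr(S²|_C) = dim C` for every finite-dimensional subcoalgebra `C ⊆ A`. -/
def Pseudoinvolutive (k A : Type u) [Field k] [Ring A] [HopfAlgebra k A] : Prop :=
  ∀ C : Submodule k A, FiniteDimensional k C →
    (∀ c ∈ C, Coalgebra.comul c ∈ LinearMap.range (map C.subtype C.subtype)) →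
    ∀ h : ∀ x ∈ C, (HopfAlgebra.antipode (R := k) ∘ₗ HopfAlgebra.antipode (R := k)) x ∈ C,
      trace k C ((HopfAlgebra.antipode (R := k) ∘ₗ HopfAlgebra.antipode (R := k)).restrict h) =
        (Module.finrank k C : k)

/-- `c ∈ A*` is a grouplike element of the dual, i.e. an algebra homomorphism `A → k`. -/
def IsGrouplikeForm (c : A →ₗ[k] k) : Prop :=
  c 1 = 1 ∧ ∀ a b : A, c (a * b) = c a * c b

/-- `c` is central in the convolution algebra `A*`. -/
def IsConvCentral (c : A →ₗ[k] k) : Prop :=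
  ∀ f : A →ₗ[k] k, conv1 c f = conv1 f c

/-- The linear form `a ⊗ b ↦ f(a) g(b)` on `A ⊗ A`. -/
def pairForm (f g : A →ₗ[k] k) : A ⊗[k] A →ₗ[k] k := mul' k k ∘ₗ map f g

/-- The cotriangular structure
`R_c = ½ (ε⊗ε + ε⊗c + c⊗ε − c⊗c)` attached to a central grouplike `c ∈ A*` of order `≤ 2`. -/
def Rc (c : A →ₗ[k] k) : A ⊗[k] A →ₗ[k] k :=
  (2⁻¹ : k) • (pairForm Coalgebra.counit Coalgebra.counit + pairForm Coalgebra.counit c +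
    pairForm c Coalgebra.counit - pairForm c c)

/-- A submodule `W ≤ V` is a subcomodule of the comodule `(V, ρ)`. -/
def IsSubcomod {V : Type u} [AddCommGroup V] [Module k V] (ρ : V →ₗ[k] V ⊗[k] A)
    (W : Submodule k V) : Prop :=
  ∀ w ∈ W, ρ w ∈ LinearMap.range (map W.subtype (LinearMap.id : A →ₗ[k] A))

/-- A linear map between comodules is a comodule morphism. -/
def IsComodMap {V W : Type u} [AddCommGroup V] [Module k V] [AddCommGroup W] [Module k W]
    (ρV : V →ₗ[k] V ⊗[k] A) (ρW : W →ₗ[k] W ⊗[k] A) (f : V →ₗ[k] W) : Prop :=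
  ρW ∘ₗ f = map f LinearMap.id ∘ₗ ρV

namespace Cotriangular

/-- The convolution algebra `A*`. -/
def ConvDual (k A : Type u) [Field k] [Ring A] [HopfAlgebra k A] : Type u :=
  WithConv (A →ₗ[k] k)

instance : Ring (ConvDual k A) := inferInstanceAs (Ring (WithConv (A →ₗ[k] k)))

instance : Algebra k (ConvDual k A) := inferInstanceAs (Algebra k (WithConv (A →ₗ[k] k)))

/-- The linear form underlying an element of `A*`. -/
def ConvDual.toForm (f : ConvDual k A) : A →ₗ[k] k := WithConv.ofConv f

/-- A linear form as an element of `A*`. -/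
def ConvDual.ofForm (f : A →ₗ[k] k) : ConvDual k A := WithConv.toConv f

@[simp]
theorem toForm_ofForm (f : A →ₗ[k] k) : (ConvDual.ofForm f).toForm = f := rfl

@[simp]
theorem ofForm_toForm (f : ConvDual k A) : ConvDual.ofForm f.toForm = f := rfl

theorem ConvDual.ext_form {f g : ConvDual k A} (h : ∀ a, f.toForm a = g.toForm a) : f = g :=
  congrArg ConvDual.ofForm (LinearMap.ext h)

@[simp]
theorem toForm_add (f g : ConvDual k A) : (f + g).toForm = f.toForm + g.toForm := rfl

@[simp]
theorem toForm_sub (f g : ConvDual k A) : (f - g).toForm = f.toForm - g.toForm := rfl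

@[simp]
theorem toForm_zero : (0 : ConvDual k A).toForm = 0 := rfl

@[simp]
theorem toForm_smul (c : k) (f : ConvDual k A) : (c • f).toForm = c • f.toForm := rfl

theorem mul_apply_eq (f g : ConvDual k A) (a : A) :
    (f * g).toForm a = mul' k k (map f.toForm g.toForm (Coalgebra.comul a)) := rfl

theorem one_apply_eq (a : A) : (1 : ConvDual k A).toForm a = Coalgebra.counit (R := k) a := rfl

theorem eq_of_forall_form {a b : A} (h : ∀ f : ConvDual k A, f.toForm a = f.toForm b) :
    a = b := by
  rw [← sub_eq_zero, ← Module.forall_dual_apply_eq_zero_iff k]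
  intro f
  simpa [sub_eq_zero] using h (ConvDual.ofForm f)

theorem eq_of_forall_pair {z w : A ⊗[k] A}
    (h : ∀ f g : A →ₗ[k] k, mul' k k (map f g z) = mul' k k (map f g w)) : z = w := by
  let b := Module.Basis.ofVectorSpace k A
  refine (b.tensorProduct b).ext_elem fun ⟨i, j⟩ => ?_
  have key : ∀ x : A ⊗[k] A, (b.tensorProduct b).repr x (i, j) =
      mul' k k (map (b.coord i) (b.coord j) x) := by
    intro x
    induction x with
    | zero => simp
    | tmul x y => simp [Module.Basis.tensorProduct_repr_tmul_apply, mul_comm]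
    | add x y hx hy => simp [hx, hy]
  rw [key, key, h]

/-- The left action `f ⇀ a = Σ a₁ f(a₂)` of `A*` on `A`. -/
def hitL (f : ConvDual k A) : A →ₗ[k] A :=
  (TensorProduct.rid k A).toLinearMap ∘ₗ map LinearMap.id f.toForm ∘ₗ Coalgebra.comul

/-- The right action `a ↼ f = Σ f(a₁) a₂` of `A*` on `A`. -/
def hitR (f : ConvDual k A) : A →ₗ[k] A :=
  (TensorProduct.lid k A).toLinearMap ∘ₗ map f.toForm LinearMap.id ∘ₗ Coalgebra.comul

theorem apply_hitL (f g : ConvDual k A) (a : A) :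
    g.toForm (hitL f a) = (g * f).toForm a := by
  simp only [hitL, mul_apply_eq, coe_comp, LinearEquiv.coe_coe, Function.comp_apply]
  induction (Coalgebra.comul (R := k) a) with
  | zero => simp
  | tmul x y => simp [mul_comm]
  | add x y hx hy => simp [hx, hy]

theorem apply_hitR (f g : ConvDual k A) (a : A) :
    g.toForm (hitR f a) = (f * g).toForm a := by
  simp only [hitR, mul_apply_eq, coe_comp, LinearEquiv.coe_coe, Function.comp_apply]
  induction (Coalgebra.comul (R := k) a) with
  | zero => simp
  | tmul x y => simp
  | add x y hx hy => simp [hx, hy]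

instance : Module (ConvDual k A) A where
  smul f a := hitL f a
  one_smul a := eq_of_forall_form (k := k) fun g => by
    change g.toForm (hitL 1 a) = _
    rw [apply_hitL, mul_one]
  mul_smul f f' a := eq_of_forall_form (k := k) fun g => by
    change g.toForm (hitL (f * f') a) = g.toForm (hitL f (hitL f' a))
    rw [apply_hitL, apply_hitL, apply_hitL, mul_assoc]
  smul_zero f := map_zero (hitL f)
  smul_add f := map_add (hitL f)
  add_smul f f' a := eq_of_forall_form (k := k) fun g => by
    change g.toForm (hitL (f + f') a) = g.toForm (hitL f a + hitL f' a)
    simp [apply_hitL, mul_add]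
  zero_smul a := eq_of_forall_form (k := k) fun g => by
    change g.toForm (hitL 0 a) = g.toForm 0
    simp [apply_hitL]

theorem apply_smul (f g : ConvDual k A) (a : A) :
    g.toForm (f • a) = (g * f).toForm a := apply_hitL f g a

instance : IsScalarTower k (ConvDual k A) A where
  smul_assoc c f a := eq_of_forall_form (k := k) fun g => by
    simp [apply_smul]

theorem hitR_smul (f g : ConvDual k A) (a : A) : hitR f (g • a) = g • hitR f a :=
  eq_of_forall_form (k := k) fun h => by
    rw [apply_hitR, apply_smul, apply_smul, apply_hitR, mul_assoc]

/-- A multiplicative matrix over `A`, i.e. the matrix of a finite-dimensional comodule. -/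
structure IsMult {ι : Type*} [Fintype ι] [DecidableEq ι] (k : Type u) {A : Type u} [Field k]
    [Ring A] [HopfAlgebra k A] (T : Matrix ι ι A) : Prop where
  comul : ∀ i j, Coalgebra.comul (R := k) (T i j) = ∑ l, T i l ⊗ₜ[k] T l j
  counit : ∀ i j, Coalgebra.counit (R := k) (T i j) = (1 : Matrix ι ι k) i j

section IsMult

variable {ι : Type*}

/-- The matrix `f(T)` over `k`. -/
def evalMat (f : ConvDual k A) (T : Matrix ι ι A) : Matrix ι ι k := T.map f.toForm

@[simp]
theorem evalMat_apply (f : ConvDual k A) (T : Matrix ι ι A) (i j : ι) :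
    evalMat f T i j = f.toForm (T i j) := rfl

variable [Fintype ι] [DecidableEq ι]

theorem IsMult.evalMat_mul {T : Matrix ι ι A} (hT : IsMult k T) (f g : ConvDual k A) :
    evalMat (f * g) T = evalMat f T * evalMat g T := by
  ext i j
  simp [mul_apply_eq, hT.comul, Matrix.mul_apply]

theorem IsMult.evalMat_one {T : Matrix ι ι A} (hT : IsMult k T) :
    evalMat (1 : ConvDual k A) T = 1 := by
  ext i j
  simp [one_apply_eq, hT.counit]

theorem IsMult.mk' {T : Matrix ι ι A}
    (hmul : ∀ f g : ConvDual k A, evalMat (f * g) T = evalMat f T * evalMat g T)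
    (hone : evalMat (1 : ConvDual k A) T = 1) : IsMult k T where
  comul i j := eq_of_forall_pair fun f g => by
    have := congr_fun (congr_fun (hmul (ConvDual.ofForm f) (ConvDual.ofForm g)) i) j
    simpa [mul_apply_eq, Matrix.mul_apply] using this
  counit i j := congr_fun (congr_fun hone i) j

end IsMult

section Rational

/-- A module over `A*` is rational if its matrix coefficients are given by elements of `A`. -/
class IsRational (k A : Type u) [Field k] [Ring A] [HopfAlgebra k A] (V : Type*)
    [AddCommGroup V] [Module k V] [Module (ConvDual k A) V] : Prop where
  exists_coef : ∀ (φ : V →ₗ[k] k) (v : V), ∃ a : A, ∀ f : ConvDual k A,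
    f.toForm a = φ (f • v)

variable {V : Type*} [AddCommGroup V] [Module k V] [Module (ConvDual k A) V]

variable (A) in
/-- The matrix coefficient `a_{φ,v} ∈ A`, characterised by `f(a_{φ,v}) = φ(f v)`. -/
def coef [IsRational k A V] (φ : V →ₗ[k] k) (v : V) : A :=
  (IsRational.exists_coef (A := A) φ v).choose

theorem apply_coef [IsRational k A V] (φ : V →ₗ[k] k) (v : V) (f : ConvDual k A) :
    f.toForm (coef A φ v) = φ (f • v) :=
  (IsRational.exists_coef (A := A) φ v).choose_spec f

theorem coef_add [IsRational k A V] (φ : V →ₗ[k] k) (v w : V) :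
    coef A φ (v + w) = coef A φ v + coef A φ w :=
  eq_of_forall_form (k := k) fun g => by simp [apply_coef]

theorem coef_add_left [IsRational k A V] (φ ψ : V →ₗ[k] k) (v : V) :
    coef A (φ + ψ) v = coef A φ v + coef A ψ v :=
  eq_of_forall_form (k := k) fun g => by simp [apply_coef]

theorem coef_smul_left [IsRational k A V] (c : k) (φ : V →ₗ[k] k) (v : V) :
    coef A (c • φ) v = c • coef A φ v :=
  eq_of_forall_form (k := k) fun g => by simp [apply_coef]

theorem coef_smul [IsRational k A V] (φ : V →ₗ[k] k) (v : V) (f : ConvDual k A) :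
    coef A φ (f • v) = f • coef A φ v :=
  eq_of_forall_form (k := k) fun g => by
    rw [apply_smul, apply_coef, apply_coef, mul_smul]

variable [IsScalarTower k (ConvDual k A) V]

theorem hitR_coef [IsRational k A V] (φ : V →ₗ[k] k) (v : V) (f : ConvDual k A) :
    hitR f (coef A φ v) = coef A (φ ∘ₗ Algebra.lsmul k k V f) v :=
  eq_of_forall_form (k := k) fun g => by
    rw [apply_hitR, apply_coef, apply_coef, mul_smul]
    rfl

/-- `v ↦ a_{φ,v}` as a morphism of `A*`-modules. -/
def coefHom [IsRational k A V] (φ : V →ₗ[k] k) : V →ₗ[ConvDual k A] A where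
  toFun := coef A φ
  map_add' := coef_add φ
  map_smul' f v := coef_smul φ v f

omit [IsScalarTower k (ConvDual k A) V] in
@[simp]
theorem coefHom_apply [IsRational k A V] (φ : V →ₗ[k] k) (v : V) :
    coefHom (A := A) φ v = coef A φ v := rfl

variable (k A V) in
/-- `(φ, v) ↦ a_{φ,v}` as a bilinear map. -/
def coefBilin [IsRational k A V] : (V →ₗ[k] k) →ₗ[k] V →ₗ[k] A :=
  LinearMap.mk₂ k (coef A) coef_add_left coef_smul_left coef_add
    (fun c φ v => ((coefHom φ).restrictScalars k).map_smul c v)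

@[simp]
theorem coefBilin_apply [IsRational k A V] (φ : V →ₗ[k] k) (v : V) :
    coefBilin k A V φ v = coef A φ v := rfl

theorem isRational_of_injective {W : Type*} [AddCommGroup W] [Module k W]
    [Module (ConvDual k A) W] [IsScalarTower k (ConvDual k A) W] [IsRational k A V]
    (i : W →ₗ[ConvDual k A] V) (hi : Function.Injective i) : IsRational k A W where
  exists_coef φ w := by
    obtain ⟨ℓ, hℓ⟩ := (i.restrictScalars k).exists_leftInverse_of_injective
      (LinearMap.ker_eq_bot.mpr hi)
    refine ⟨coef A (φ ∘ₗ ℓ) (i w), fun f => ?_⟩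
    rw [apply_coef, ← map_smul]
    exact congrArg φ (LinearMap.congr_fun hℓ (f • w))

theorem isRational_of_surjective {W : Type*} [AddCommGroup W] [Module k W]
    [Module (ConvDual k A) W] [IsScalarTower k (ConvDual k A) W] [IsRational k A V]
    (p : V →ₗ[ConvDual k A] W) (hp : Function.Surjective p) : IsRational k A W where
  exists_coef φ w := by
    obtain ⟨v, rfl⟩ := hp w
    refine ⟨coef A (φ ∘ₗ p.restrictScalars k) v, fun f => ?_⟩
    rw [apply_coef, ← map_smul]
    rfl

instance [IsRational k A V] (W : Submodule (ConvDual k A) V) : IsRational k A W :=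
  isRational_of_injective W.subtype W.injective_subtype

instance [IsRational k A V] (W : Submodule (ConvDual k A) V) : IsRational k A (V ⧸ W) :=
  isRational_of_surjective W.mkQ W.mkQ_surjective

instance : IsRational k A A where
  exists_coef φ a := ⟨hitR (ConvDual.ofForm φ) a, fun f => by
    rw [apply_hitR]; exact (apply_smul f (ConvDual.ofForm φ) a).symm⟩

/-- The matrix of coefficients of a module with respect to a basis. -/
def coefMat {ι : Type*} [IsRational k A V] (b : Module.Basis ι k V) : Matrix ι ι A :=
  fun i j => coef A (b.coord i) (b j)

variable {ι : Type*} [Fintype ι] [DecidableEq ι]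

theorem evalMat_coefMat [IsRational k A V] (b : Module.Basis ι k V) (f : ConvDual k A) :
    evalMat f (coefMat (A := A) b) = LinearMap.toMatrix b b (Algebra.lsmul k k V f) := by
  ext i j
  simp [coefMat, apply_coef, LinearMap.toMatrix_apply]

theorem isMult_coefMat [IsRational k A V] (b : Module.Basis ι k V) :
    IsMult k (coefMat (A := A) b) :=
  .mk' (fun f g => by simp [evalMat_coefMat, LinearMap.toMatrix_mul])
    (by simp [evalMat_coefMat])

theorem trace_smul_eq [IsRational k A V] (b : Module.Basis ι k V) (f : ConvDual k A) :
    trace k V (Algebra.lsmul k k V f) = (evalMat f (coefMat (A := A) b)).trace := by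
  rw [evalMat_coefMat, LinearMap.trace_eq_matrix_trace k b]

end Rational

/-- Every element of `A` lies in a finite-dimensional `A*`-submodule. -/
theorem finiteDimensional_span (a : A) :
    FiniteDimensional k (Submodule.span (ConvDual k A) {a}) := by
  obtain ⟨S, hS⟩ := TensorProduct.exists_finset (R := k) (Coalgebra.comul (R := k) a)
  let W : Submodule k A := Submodule.span k (Prod.fst '' (S : Set (A × A)))
  have hle : (Submodule.span (ConvDual k A) {a}).restrictScalars k ≤ W := by
    intro x hx
    obtain ⟨f, rfl⟩ := Submodule.mem_span_singleton.mp hx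
    change hitL f a ∈ W
    simp only [hitL, coe_comp, LinearEquiv.coe_coe, Function.comp_apply, hS, map_sum]
    refine W.sum_mem fun i hi => ?_
    simp only [map_tmul, id_coe, id_eq, TensorProduct.rid_tmul]
    exact W.smul_mem _ (Submodule.subset_span ⟨i, hi, rfl⟩)
  have : FiniteDimensional k W := FiniteDimensional.span_of_finite k ((Finset.finite_toSet S).image _)
  exact Submodule.finiteDimensional_of_le hle

theorem mem_span_coefMat {ι : Type*} [Fintype ι] [DecidableEq ι]
    (N : Submodule (ConvDual k A) A) (b : Module.Basis ι k N) (a : A) (ha : a ∈ N) :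
    a ∈ Submodule.span k (Set.range fun ij : ι × ι => coefMat (A := A) b ij.1 ij.2) := by
  have hcoe : ∀ x : N, (x : A) = ∑ j, b.repr x j • (b j : A) := fun x => by
    have := congrArg (N.subtype.restrictScalars k) (b.sum_repr x).symm
    rw [map_sum] at this
    simp only [map_smul] at this
    exact this
  have key : ∀ j, (b j : A) = ∑ i, Coalgebra.counit (R := k) (b i : A) • coefMat (A := A) b i j := by
    intro j
    refine eq_of_forall_form (k := k) fun f => ?_
    have h1 : f.toForm (b j : A) = Coalgebra.counit (R := k) ((f • b j : N) : A) := by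
      rw [← one_apply_eq, Submodule.coe_smul, apply_smul, one_mul]
    rw [h1, hcoe (f • b j), map_sum, map_sum]
    refine Finset.sum_congr rfl fun i _ => ?_
    rw [(Coalgebra.counit (R := k)).map_smul, f.toForm.map_smul, coefMat, apply_coef, smul_eq_mul,
      smul_eq_mul, mul_comm, Module.Basis.coord_apply]
  have := hcoe ⟨a, ha⟩
  change a = _ at this
  rw [this]
  refine Submodule.sum_mem _ fun j _ => Submodule.smul_mem _ _ ?_
  rw [key j]
  exact Submodule.sum_mem _ fun i _ => Submodule.smul_mem _ _ (Submodule.subset_span ⟨(i, j), rfl⟩)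

/-- Linear forms on `A` that agree on entries of multiplicative matrices are equal; more
generally any property closed under linear combinations may be checked on such entries. -/
theorem mult_induction {p : A → Prop}
    (hmat : ∀ (n : ℕ) (T : Matrix (Fin n) (Fin n) A), IsMult k T → ∀ i j, p (T i j))
    (hzero : p 0) (hadd : ∀ a b, p a → p b → p (a + b)) (hsmul : ∀ (c : k) a, p a → p (c • a))
    (a : A) : p a := by
  have := finiteDimensional_span (k := k) a
  have b := Module.finBasis k (Submodule.span (ConvDual k A) {a})
  refine Submodule.span_induction (p := fun x _ => p x) ?_ hzero (fun x y _ _ => hadd x y)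
    (fun c x _ => hsmul c x) (mem_span_coefMat _ b a (Submodule.mem_span_singleton_self a))
  rintro _ ⟨⟨i, j⟩, rfl⟩
  exact hmat _ _ (isMult_coefMat b) i j

end Cotriangular

namespace Cotriangular

section LinearAlgebra

variable {U V W : Type*} [AddCommGroup U] [Module k U] [AddCommGroup V] [Module k V]
  [AddCommGroup W] [Module k W] [FiniteDimensional k U] [FiniteDimensional k V]
  [FiniteDimensional k W]

omit [FiniteDimensional k U] [FiniteDimensional k V] [FiniteDimensional k W] in
theorem exists_splitting {i : U →ₗ[k] V} {p : V →ₗ[k] W} (hi : Function.Injective i)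
    (hp : Function.Surjective p) (hex : LinearMap.range i = LinearMap.ker p) :
    ∃ (π : V →ₗ[k] U) (σ : W →ₗ[k] V), π ∘ₗ i = LinearMap.id ∧ p ∘ₗ σ = LinearMap.id ∧
      i ∘ₗ π + σ ∘ₗ p = LinearMap.id := by
  obtain ⟨π, hπ⟩ := i.exists_leftInverse_of_injective (LinearMap.ker_eq_bot.mpr hi)
  obtain ⟨σ, hσ⟩ := p.exists_rightInverse_of_surjective (LinearMap.range_eq_top.mpr hp)
  have hπ' (u : U) : π (i u) = u := LinearMap.congr_fun hπ u
  have hσ' (w : W) : p (σ w) = w := LinearMap.congr_fun hσ w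
  have hpi (u : U) : p (i u) = 0 := LinearMap.mem_ker.mp (hex ▸ LinearMap.mem_range_self i u)
  refine ⟨π ∘ₗ (LinearMap.id - σ ∘ₗ p), σ, ?_, hσ, ?_⟩
  · ext u
    simp [hπ', hpi]
  · ext v
    have hv : v - σ (p v) ∈ LinearMap.range i := by
      rw [hex, LinearMap.mem_ker, map_sub, hσ', sub_self]
    obtain ⟨u, hu⟩ := hv
    simp [← hu, hπ']
    simp [hu]

/-- Additivity of the trace in short exact sequences. -/
theorem trace_eq_add_of_exact {i : U →ₗ[k] V} {p : V →ₗ[k] W} (hi : Function.Injective i)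
    (hp : Function.Surjective p) (hex : LinearMap.range i = LinearMap.ker p)
    {φ : V →ₗ[k] V} {φU : U →ₗ[k] U} {φW : W →ₗ[k] W} (hU : φ ∘ₗ i = i ∘ₗ φU)
    (hW : p ∘ₗ φ = φW ∘ₗ p) : trace k V φ = trace k U φU + trace k W φW := by
  obtain ⟨π, σ, hπ, hσ, hsum⟩ := exists_splitting hi hp hex
  have h1 : trace k V (φ ∘ₗ i ∘ₗ π) = trace k U φU := by
    rw [← LinearMap.comp_assoc, hU, LinearMap.comp_assoc, LinearMap.trace_comp_comm',
      LinearMap.comp_assoc, hπ, LinearMap.comp_id]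
  have h2 : trace k V (φ ∘ₗ σ ∘ₗ p) = trace k W φW := by
    rw [← LinearMap.comp_assoc, LinearMap.trace_comp_comm', ← LinearMap.comp_assoc, hW,
      LinearMap.comp_assoc, hσ, LinearMap.comp_id]
  rw [← h1, ← h2, ← map_add, ← LinearMap.comp_add, hsum, LinearMap.comp_id]

end LinearAlgebra

section Burnside

variable {H V : Type*} [Ring H] [Algebra k H] [AddCommGroup V] [Module k V] [Module H V]
  [IsScalarTower k H V] [FiniteDimensional k V] [IsAlgClosed k]

theorem exists_eq_smul_of_isSimpleModule [IsSimpleModule H V] (g : V →ₗ[H] V) :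
    ∃ c : k, ∀ v, g v = c • v := by
  have : Nontrivial V := IsSimpleModule.nontrivial H V
  obtain ⟨c, hc⟩ := Module.End.exists_eigenvalue (g.restrictScalars k)
  let N : Submodule H V :=
    { carrier := {v | g v = c • v}
      add_mem' := fun {v w} hv hw => by simp_all
      zero_mem' := by simp
      smul_mem' := fun f v hv => by
        simp only [Set.mem_ofPred_eq, map_smul] at hv ⊢
        rw [hv, smul_algebra_smul_comm] }
  obtain ⟨v, hv⟩ := hc.exists_hasEigenvector
  have hN : N = ⊤ := by
    refine (eq_bot_or_eq_top N).resolve_left fun h => hv.2 ?_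
    have : v ∈ N := hv.apply_eq_smul
    simpa [h] using this
  exact ⟨c, fun v => (hN ▸ Submodule.mem_top : v ∈ N)⟩

/-- Burnside's theorem. -/
theorem exists_smul_eq_of_isSimpleModule [IsSimpleModule H V] (φ : V →ₗ[k] V) :
    ∃ f : H, ∀ v, f • v = φ v := by
  classical
  let b := Module.finBasis k V
  let ψ : Module.End (Module.End H V) V :=
    { toFun := φ
      map_add' := map_add φ
      map_smul' := fun g v => by
        obtain ⟨c, hc⟩ := exists_eq_smul_of_isSimpleModule (k := k) g
        simp [hc] }
  obtain ⟨f, hf⟩ := jacobson_density ψ (Finset.univ.image b)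
  refine ⟨f, fun v => ?_⟩
  change Algebra.lsmul k k V f v = _
  congr 1
  refine b.ext fun i => (hf (b i) (by simp)).symm

end Burnside

end Cotriangular

namespace Cotriangular

open scoped Matrix

/-- Conjugation `a ↦ Σ u(a₁) a₂ u'(a₃)`. -/
def twist (u u' : ConvDual k A) : A →ₗ[k] A := hitL u' ∘ₗ hitR u

/-- A subspace of `A` stable under both actions of `A*`, i.e. a subcoalgebra. -/
structure IsBistable (F : Submodule k A) : Prop where
  smul_mem : ∀ (f : ConvDual k A), ∀ a ∈ F, f • a ∈ F
  hitR_mem : ∀ (f : ConvDual k A), ∀ a ∈ F, hitR f a ∈ F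

theorem IsBistable.twist_mem {F : Submodule k A} (hF : IsBistable F) (u u' : ConvDual k A) :
    ∀ a ∈ F, twist u u' a ∈ F :=
  fun a ha => hF.smul_mem u' _ (hF.hitR_mem u a ha)

/-- The properties of the Drinfeld element `u` and its inverse `u'` that follow from
pseudoinvolutivity and cotriangularity. -/
structure IsPseudoUnit (u u' : ConvDual k A) : Prop where
  mul_inv : u * u' = 1
  inv_mul : u' * u = 1
  trace_twist : ∀ (F : Submodule k A) [FiniteDimensional k F] (hF : IsBistable F),
    trace k F ((twist u u').restrict (hF.twist_mem u u')) = (Module.finrank k F : k)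
  trace_symm : ∀ (n : ℕ) (T : Matrix (Fin n) (Fin n) A), IsMult k T →
    (evalMat u' T).trace = (evalMat u T).trace

section MatrixTrace

variable {m n : Type*} [Fintype m] [Fintype n] [DecidableEq m] [DecidableEq n]

/-- The map `X ↦ P X Q` on matrices. -/
def sandwich (P : Matrix m m k) (Q : Matrix n n k) : Matrix m n k →ₗ[k] Matrix m n k where
  toFun X := P * X * Q
  map_add' X Y := by rw [Matrix.mul_add, Matrix.add_mul]
  map_smul' c X := by simp

theorem trace_sandwich (P : Matrix m m k) (Q : Matrix n n k) :
    trace k _ (sandwich P Q) = P.trace * Q.trace := by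
  rw [LinearMap.trace_eq_matrix_trace k (Matrix.stdBasis k m n), Matrix.trace,
    Fintype.sum_prod_type, Matrix.trace, Matrix.trace, Finset.sum_mul_sum]
  refine Finset.sum_congr rfl fun i _ => Finset.sum_congr rfl fun j _ => ?_
  have hrepr (X : Matrix m n k) : (Matrix.stdBasis k m n).repr X (i, j) = X i j := by
    simp [Matrix.stdBasis]
  rw [Matrix.diag_apply, LinearMap.toMatrix_apply, hrepr, Matrix.stdBasis_eq_single]
  simp [sandwich, Matrix.mul_apply, Matrix.single_apply, ite_and]

end MatrixTrace

set_option maxHeartbeats 1000000 in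
/-- The key dichotomy: a family `Z` transforming modulo `F` like matrix coefficients between two
absolutely simple comodules either lies in `F`, or the signs of these comodules agree. -/
theorem IsPseudoUnit.dichotomy {u u' : ConvDual k A} (hu : IsPseudoUnit u u')
    {m n : ℕ} {F : Submodule k A} [FiniteDimensional k F] (hF : IsBistable F)
    (Z : Matrix (Fin m) (Fin n) A)
    (hC : IsBistable (F ⊔ Submodule.span k (Set.range fun ij : Fin m × Fin n => Z ij.1 ij.2)))
    (TY : Matrix (Fin m) (Fin m) A) (TX : Matrix (Fin n) (Fin n) A) (hTX : IsMult k TX)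
    (hsY : ∀ M, ∃ f : ConvDual k A, evalMat f TY = M)
    (hsX : ∀ M, ∃ f : ConvDual k A, evalMat f TX = M)
    (hL : ∀ (f : ConvDual k A) i j, f • Z i j - ∑ l, f.toForm (TX l j) • Z i l ∈ F)
    (hR : ∀ (f : ConvDual k A) i j, hitR f (Z i j) - ∑ l, f.toForm (TY i l) • Z l j ∈ F) :
    (∀ i j, Z i j ∈ F) ∨ (evalMat u TY).trace * (evalMat u TX).trace = (m * n : k) := by
  let ζ : Matrix (Fin m) (Fin n) k →ₗ[k] A :=
    { toFun := fun c => ∑ i, ∑ j, c i j • Z i j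
      map_add' := fun c d => by simp [add_smul, Finset.sum_add_distrib]
      map_smul' := fun r c => by simp [mul_smul, Finset.smul_sum] }
  have hζ (c) : ζ c = ∑ i, ∑ j, c i j • Z i j := rfl
  have hζL (f : ConvDual k A) (c) : f • ζ c - ζ (c * (evalMat f TX)ᵀ) ∈ F := by
    have : f • ζ c - ζ (c * (evalMat f TX)ᵀ) =
        ∑ i, ∑ j, c i j • (f • Z i j - ∑ l, f.toForm (TX l j) • Z i l) := by
      simp only [hζ, smul_sub, Finset.sum_sub_distrib, Finset.smul_sum, Matrix.mul_apply,
        Finset.sum_smul, Matrix.transpose_apply, evalMat_apply, mul_smul]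
      congr 1
      · simp only [smul_algebra_smul_comm]
      · exact Finset.sum_congr rfl fun i _ => Finset.sum_comm
    rw [this]
    exact F.sum_mem fun i _ => F.sum_mem fun j _ => F.smul_mem _ (hL f i j)
  have hζR (f : ConvDual k A) (c) : hitR f (ζ c) - ζ ((evalMat f TY)ᵀ * c) ∈ F := by
    have : hitR f (ζ c) - ζ ((evalMat f TY)ᵀ * c) =
        ∑ i, ∑ j, c i j • (hitR f (Z i j) - ∑ l, f.toForm (TY i l) • Z l j) := by
      simp only [hζ, smul_sub, Finset.sum_sub_distrib, Finset.smul_sum, Matrix.mul_apply,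
        Finset.sum_smul, Matrix.transpose_apply, evalMat_apply, map_sum, map_smul]
      congr 1
      rw [Finset.sum_congr rfl fun i _ => Finset.sum_comm, Finset.sum_comm]
      refine Finset.sum_congr rfl fun l _ => ?_
      rw [Finset.sum_comm]
      simp only [smul_smul, mul_comm]
    rw [this]
    exact F.sum_mem fun i _ => F.sum_mem fun j _ => F.smul_mem _ (hR f i j)
  by_cases hK : ∃ c, ζ c ∈ F ∧ c ≠ 0
  · left
    obtain ⟨c, hc, hc0⟩ := hK
    obtain ⟨p, q, hpq⟩ : ∃ p q, c p q ≠ 0 := by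
      by_contra! h
      exact hc0 (Matrix.ext h)
    have hKL (c) (hc : ζ c ∈ F) (M : Matrix (Fin n) (Fin n) k) : ζ (c * M) ∈ F := by
      obtain ⟨f, hf⟩ := hsX Mᵀ
      have := F.sub_mem (hF.smul_mem f _ hc) (hζL f c)
      simpa [hf] using this
    have hKR (c) (hc : ζ c ∈ F) (M : Matrix (Fin m) (Fin m) k) : ζ (M * c) ∈ F := by
      obtain ⟨f, hf⟩ := hsY Mᵀ
      have := F.sub_mem (hF.hitR_mem f _ hc) (hζR f c)
      simpa [hf] using this
    intro i j
    have h1 := hKR _ (hKL c hc (Matrix.single q j 1)) (Matrix.single i p 1)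
    rw [← Matrix.mul_assoc, Matrix.single_mul_mul_single] at h1
    have h2 : ζ (Matrix.single i j (1 * c p q * 1)) = c p q • Z i j := by
      simp [hζ, Matrix.single_apply, ite_and]
    rw [h2] at h1
    exact (F.smul_mem_iff hpq).mp h1
  · right
    push Not at hK
    set C := F ⊔ Submodule.span k (Set.range fun ij : Fin m × Fin n => Z ij.1 ij.2) with hCdef
    have hZC (i j) : Z i j ∈ C :=
      Submodule.mem_sup_right (Submodule.subset_span ⟨(i, j), rfl⟩)
    have hζC (c) : ζ c ∈ C := by
      rw [hζ]
      exact C.sum_mem fun i _ => C.sum_mem fun j _ => C.smul_mem _ (hZC i j)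
    have hFC : F ≤ C := le_sup_left
    let g : (F × Matrix (Fin m) (Fin n) k) →ₗ[k] C :=
      LinearMap.coprod (Submodule.inclusion hFC) (ζ.codRestrict C hζC)
    have hgv (x) : (g x : A) = (x.1 : A) + ζ x.2 := rfl
    have hginj : Function.Injective g := by
      rw [← LinearMap.ker_eq_bot, LinearMap.ker_eq_bot']
      rintro ⟨a, c⟩ h
      have h1 : (a : A) + ζ c = 0 := congrArg Subtype.val h
      have h2 : c = 0 := hK c (by
        rw [eq_neg_of_add_eq_zero_right h1]; exact F.neg_mem a.2)
      rw [h2, map_zero, add_zero] at h1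
      exact Prod.ext (Subtype.ext h1) h2
    have hgsurj : Function.Surjective g := by
      rintro ⟨x, hx⟩
      obtain ⟨a, ha, z, hz, rfl⟩ := Submodule.mem_sup.mp hx
      have : ∃ c, ζ c = z := by
        have : Submodule.span k (Set.range fun ij : Fin m × Fin n => Z ij.1 ij.2) ≤
            LinearMap.range ζ := by
          rw [Submodule.span_le]
          rintro _ ⟨⟨i, j⟩, rfl⟩
          exact ⟨Matrix.single i j 1, by simp [hζ, Matrix.single_apply, ite_and]⟩
        exact this hz
      obtain ⟨c, rfl⟩ := this
      exact ⟨(⟨a, ha⟩, c), rfl⟩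
    let e := LinearEquiv.ofBijective g ⟨hginj, hgsurj⟩
    have he (x) : (e x : A) = (x.1 : A) + ζ x.2 := rfl
    have : FiniteDimensional k C := e.finiteDimensional
    let p : C →ₗ[k] Matrix (Fin m) (Fin n) k := LinearMap.snd k _ _ ∘ₗ e.symm.toLinearMap
    have hpe (x) : p (e x) = x.2 := by simp [p]
    have hp0 (a : C) (ha : (a : A) ∈ F) : p a = 0 := by
      have : a = e (⟨a, ha⟩, 0) := Subtype.ext (by simp [he])
      rw [this, hpe]
    have hpζ (c) : p ⟨ζ c, hζC c⟩ = c := by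
      have : (⟨ζ c, hζC c⟩ : C) = e (0, c) := Subtype.ext (by simp [he])
      rw [this, hpe]
    have htr := trace_eq_add_of_exact (k := k) (i := Submodule.inclusion hFC) (p := p)
      (φ := (twist u u').restrict (hC.twist_mem u u'))
      (φU := (twist u u').restrict (hF.twist_mem u u'))
      (φW := sandwich (evalMat u TY)ᵀ (evalMat u' TX)ᵀ)
      (Submodule.inclusion_injective hFC)
      (fun c => ⟨e (0, c), hpe _⟩) ?_ rfl ?_
    · rw [hu.trace_twist F hF, hu.trace_twist C hC, trace_sandwich, Matrix.trace_transpose,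
        Matrix.trace_transpose, hu.trace_symm _ _ hTX, ← e.finrank_eq] at htr
      simpa [Module.finrank_prod, Module.finrank_matrix] using htr.symm
    · ext a
      simp only [LinearMap.mem_range, LinearMap.mem_ker]
      constructor
      · rintro ⟨b, rfl⟩
        exact hp0 _ b.2
      · intro h
        obtain ⟨x, rfl⟩ := e.surjective a
        rw [hpe] at h
        exact ⟨x.1, Subtype.ext (by simp [he, h])⟩
    · refine LinearMap.ext fun a => ?_
      obtain ⟨⟨a, c⟩, rfl⟩ := e.surjective a
      have h1 : twist u u' (ζ c) - ζ (sandwich (evalMat u TY)ᵀ (evalMat u' TX)ᵀ c) ∈ F := by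
        have h2 := hF.smul_mem u' _ (hζR u c)
        have h3 := F.add_mem h2 (hζL u' ((evalMat u TY)ᵀ * c))
        rw [smul_sub, sub_add_sub_cancel] at h3
        exact h3
      have h4 : ((twist u u').restrict (hC.twist_mem u u')) (e (a, c)) =
          ⟨_, hFC (F.add_mem (hF.twist_mem u u' a a.2) h1)⟩ + ⟨_, hζC (sandwich (evalMat u TY)ᵀ (evalMat u' TX)ᵀ c)⟩ :=
        Subtype.ext (by simp [he, add_assoc])
      simp only [LinearMap.comp_apply, hpe]
      rw [h4, map_add, hpζ, hp0 _ (F.add_mem (hF.twist_mem u u' a a.2) h1), zero_add]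

end Cotriangular

namespace Cotriangular

section Trace

variable {V : Type u} [AddCommGroup V] [Module k V] [Module (ConvDual k A) V]
  [IsScalarTower k (ConvDual k A) V]
  {W : Type u} [AddCommGroup W] [Module k W] [Module (ConvDual k A) W]
  [IsScalarTower k (ConvDual k A) W]

instance [FiniteDimensional k V] (N : Submodule (ConvDual k A) V) : FiniteDimensional k N :=
  .of_injective (N.subtype.restrictScalars k) N.injective_subtype

instance [FiniteDimensional k V] (N : Submodule (ConvDual k A) V) : FiniteDimensional k (V ⧸ N) :=
  .of_surjective (N.mkQ.restrictScalars k) N.mkQ_surjective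

instance (a : A) : FiniteDimensional k (Submodule.span (ConvDual k A) {a}) :=
  finiteDimensional_span a

variable (V) in
/-- The trace of `f ∈ A*` on a module. -/
def traceOn (f : ConvDual k A) : k := trace k V (Algebra.lsmul k k V f)

theorem traceOn_sub (f g : ConvDual k A) : traceOn V (f - g) = traceOn V f - traceOn V g := by
  simp [traceOn]

theorem traceOn_smul (c : k) (f : ConvDual k A) : traceOn V (c • f) = c * traceOn V f := by
  simp [traceOn]

theorem traceOn_one [FiniteDimensional k V] : traceOn V (1 : ConvDual k A) = Module.finrank k V := by
  rw [traceOn, map_one, LinearMap.trace_one]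

theorem traceOn_of_subsingleton [Subsingleton V] (f : ConvDual k A) : traceOn V f = 0 := by
  rw [traceOn, Subsingleton.elim (Algebra.lsmul k k V f) 0, map_zero]

theorem traceOn_congr (e : V ≃ₗ[ConvDual k A] W) (f : ConvDual k A) :
    traceOn V f = traceOn W f := by
  rw [traceOn, traceOn, ← LinearMap.trace_conj' _ (e.restrictScalars k)]
  congr 1
  ext w
  simp [LinearEquiv.conj_apply]

theorem traceOn_eq_add [FiniteDimensional k V] (N : Submodule (ConvDual k A) V)
    (f : ConvDual k A) : traceOn V f = traceOn N f + traceOn (V ⧸ N) f := by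
  refine trace_eq_add_of_exact (i := N.subtype.restrictScalars k) (p := N.mkQ.restrictScalars k)
    N.injective_subtype N.mkQ_surjective ?_ rfl rfl
  ext v
  simp

theorem finrank_eq_add [FiniteDimensional k V] (N : Submodule (ConvDual k A) V) :
    Module.finrank k V = Module.finrank k N + Module.finrank k (V ⧸ N) := by
  rw [add_comm]
  exact (Submodule.finrank_quotient_add_finrank (N.restrictScalars k)).symm

theorem exists_isSimpleModule_le [FiniteDimensional k V] (M : Submodule (ConvDual k A) V)
    (hM : M ≠ ⊥) : ∃ N ≤ M, IsSimpleModule (ConvDual k A) N := by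
  have : IsArtinian (ConvDual k A) V := isArtinian_of_tower k inferInstance
  obtain ⟨N, hN, hle⟩ := (eq_bot_or_exists_atom_le M).resolve_left hM
  exact ⟨N, hle, isSimpleModule_iff_isAtom.mpr hN⟩

theorem exists_isSimpleModule_quotient [FiniteDimensional k V] [Nontrivial V] :
    ∃ N : Submodule (ConvDual k A) V, IsSimpleModule (ConvDual k A) (V ⧸ N) := by
  have : IsNoetherian (ConvDual k A) V := isNoetherian_of_tower k inferInstance
  obtain ⟨N, hN, -⟩ := (eq_top_or_exists_le_coatom (⊥ : Submodule (ConvDual k A) V)).resolve_left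
    bot_ne_top
  exact ⟨N, isSimpleModule_iff_isCoatom.mpr hN⟩

omit [IsScalarTower k (ConvDual k A) V] in
theorem finrank_pos_of_isSimpleModule [FiniteDimensional k V]
    [IsSimpleModule (ConvDual k A) V] : 0 < Module.finrank k V :=
  have := IsSimpleModule.nontrivial (ConvDual k A) V
  Module.finrank_pos

/-- The trace on a module is a sum of traces on simple modules. -/
theorem traceOn_mem_of_isSimpleModule (S : AddSubmonoid k) (f : ConvDual k A)
    (h : ∀ (V : Type u) [AddCommGroup V] [Module k V] [Module (ConvDual k A) V]
      [IsScalarTower k (ConvDual k A) V] [IsRational k A V] [FiniteDimensional k V]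
      [IsSimpleModule (ConvDual k A) V], traceOn V f ∈ S)
    (V : Type u) [AddCommGroup V] [Module k V] [Module (ConvDual k A) V]
    [IsScalarTower k (ConvDual k A) V] [IsRational k A V] [FiniteDimensional k V] :
    traceOn V f ∈ S := by
  induction hd : Module.finrank k V using Nat.strong_induction_on generalizing V with
  | _ d ih =>
    rcases subsingleton_or_nontrivial V with hV | hV
    · rw [traceOn_of_subsingleton]
      exact S.zero_mem
    · obtain ⟨N, -, hN⟩ := exists_isSimpleModule_le (⊤ : Submodule (ConvDual k A) V) top_ne_bot
      rw [traceOn_eq_add N]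
      have h1 := finrank_eq_add N
      have h2 := finrank_pos_of_isSimpleModule (k := k) (A := A) (V := N)
      exact S.add_mem (h N) (ih _ (by omega) (V ⧸ N) rfl)

end Trace

section Coefficients

variable {V : Type u} [AddCommGroup V] [Module k V] [Module (ConvDual k A) V]
  [IsScalarTower k (ConvDual k A) V] [IsRational k A V]

omit [IsScalarTower k (ConvDual k A) V] in
theorem counit_coef (φ : V →ₗ[k] k) (v : V) : Coalgebra.counit (R := k) (coef A φ v) = φ v := by
  rw [← one_apply_eq, apply_coef, one_smul]

theorem coef_submodule (N : Submodule (ConvDual k A) V) (φ : V →ₗ[k] k) (v : N) :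
    coef A (φ ∘ₗ N.subtype.restrictScalars k) v = coef A φ (v : V) :=
  eq_of_forall_form (k := k) fun f => by
    rw [apply_coef, apply_coef]
    rfl

omit [IsRational k A V] in
theorem exists_coef_submodule (N : Submodule (ConvDual k A) V) (φ : N →ₗ[k] k) :
    ∃ ψ : V →ₗ[k] k, ψ ∘ₗ N.subtype.restrictScalars k = φ := by
  obtain ⟨ℓ, hℓ⟩ := (N.subtype.restrictScalars k).exists_leftInverse_of_injective
    (LinearMap.ker_eq_bot.mpr N.injective_subtype)
  exact ⟨φ ∘ₗ ℓ, by rw [LinearMap.comp_assoc, hℓ, LinearMap.comp_id]⟩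

theorem coef_quotient (N : Submodule (ConvDual k A) V) (φ : (V ⧸ N) →ₗ[k] k) (v : V) :
    coef A φ (N.mkQ v) = coef A (φ ∘ₗ N.mkQ.restrictScalars k) v :=
  eq_of_forall_form (k := k) fun f => by
    rw [apply_coef, apply_coef]
    rfl

theorem exists_evalMat_coefMat_eq [IsAlgClosed k] [FiniteDimensional k V]
    [IsSimpleModule (ConvDual k A) V] {ι : Type*} [Fintype ι] [DecidableEq ι]
    (b : Module.Basis ι k V) (M : Matrix ι ι k) :
    ∃ f : ConvDual k A, evalMat f (coefMat b) = M := by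
  obtain ⟨f, hf⟩ := exists_smul_eq_of_isSimpleModule (H := ConvDual k A) (Matrix.toLin b b M)
  refine ⟨f, ?_⟩
  rw [evalMat_coefMat, show Algebra.lsmul k k V f = Matrix.toLin b b M from LinearMap.ext hf,
    LinearMap.toMatrix_toLin]

theorem traceOn_eq_trace_evalMat {ι : Type*} [Fintype ι] [DecidableEq ι]
    (b : Module.Basis ι k V) (f : ConvDual k A) :
    traceOn V f = (evalMat f (coefMat (A := A) b)).trace := trace_smul_eq b f

omit [IsScalarTower k (ConvDual k A) V] in
theorem coef_sum (φ : V →ₗ[k] k) {ι : Type*} (s : Finset ι) (v : ι → V) :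
    coef A φ (∑ i ∈ s, v i) = ∑ i ∈ s, coef A φ (v i) :=
  map_sum (coefHom φ) v s

theorem coef_smul_right (φ : V →ₗ[k] k) (c : k) (v : V) :
    coef A φ (c • v) = c • coef A φ v := (coefBilin k A V φ).map_smul c v

theorem coef_sub (φ : V →ₗ[k] k) (v w : V) :
    coef A φ (v - w) = coef A φ v - coef A φ w := (coefBilin k A V φ).map_sub v w

theorem coef_sum_left {ι : Type*} (s : Finset ι) (φ : ι → V →ₗ[k] k) (v : V) :
    coef A (∑ i ∈ s, φ i) v = ∑ i ∈ s, coef A (φ i) v := by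
  exact map_sum ((coefBilin k A V).flip v) φ s

theorem coef_sub_left (φ ψ : V →ₗ[k] k) (v : V) :
    coef A (φ - ψ) v = coef A φ v - coef A ψ v := by
  exact map_sub ((coefBilin k A V).flip v) φ ψ

/-- The coefficients of a finite-dimensional module span a finite-dimensional space. -/
theorem finiteDimensional_span_coef [FiniteDimensional k V] (P : (V →ₗ[k] k) → V → Prop) :
    FiniteDimensional k (Submodule.span k {a : A | ∃ φ v, P φ v ∧ coef A φ v = a}) := by
  let b := Module.finBasis k V
  have hfd : FiniteDimensional k (Submodule.span k
      (Set.range fun ij : Fin _ × Fin _ => coefMat (A := A) b ij.1 ij.2)) :=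
    FiniteDimensional.span_of_finite k (Set.finite_range _)
  refine Submodule.finiteDimensional_of_le (S₂ := Submodule.span k
    (Set.range fun ij : Fin _ × Fin _ => coefMat (A := A) b ij.1 ij.2)) ?_
  rw [Submodule.span_le]
  rintro _ ⟨φ, v, -, rfl⟩
  have hφ : φ = ∑ i, φ (b i) • b.coord i := b.ext fun j => by
    simp
  rw [SetLike.mem_coe, hφ, ← b.sum_repr v]
  rw [coef_sum_left]
  refine Submodule.sum_mem _ fun i _ => ?_
  rw [coef_smul_left, coef_sum]
  refine Submodule.smul_mem _ _ (Submodule.sum_mem _ fun j _ => ?_)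
  rw [coef_smul_right]
  exact Submodule.smul_mem _ _ (Submodule.subset_span ⟨(i, j), rfl⟩)

theorem isBistable_span_coef (P : (V →ₗ[k] k) → V → Prop)
    (hR : ∀ φ v (f : ConvDual k A), P φ v → P φ (f • v))
    (hL : ∀ φ v (f : ConvDual k A), P φ v → P (φ ∘ₗ Algebra.lsmul k k V f) v) :
    IsBistable (Submodule.span k {a : A | ∃ φ v, P φ v ∧ coef A φ v = a}) where
  smul_mem f a ha := by
    change hitL f a ∈ _
    rw [← Submodule.mem_comap]
    refine Submodule.span_le.mpr ?_ ha
    rintro _ ⟨φ, v, h, rfl⟩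
    exact Submodule.subset_span ⟨φ, f • v, hR _ _ _ h, coef_smul φ v f⟩
  hitR_mem f a ha := by
    rw [← Submodule.mem_comap]
    refine Submodule.span_le.mpr ?_ ha
    rintro _ ⟨φ, v, h, rfl⟩
    exact Submodule.subset_span ⟨_, v, hL _ _ f h, (hitR_coef φ v f).symm⟩

end Coefficients

theorem IsBistable.sup_span {m n : Type*} [Fintype m] [Fintype n] {F : Submodule k A}
    (hF : IsBistable F) (Z : Matrix m n A) (TY : Matrix m m A) (TX : Matrix n n A)
    (hL : ∀ (f : ConvDual k A) i j, f • Z i j - ∑ l, f.toForm (TX l j) • Z i l ∈ F)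
    (hR : ∀ (f : ConvDual k A) i j, hitR f (Z i j) - ∑ l, f.toForm (TY i l) • Z l j ∈ F) :
    IsBistable (F ⊔ Submodule.span k (Set.range fun ij : m × n => Z ij.1 ij.2)) := by
  set G := Submodule.span k (Set.range fun ij : m × n => Z ij.1 ij.2) with hG
  have hZ (i j) : Z i j ∈ G := Submodule.subset_span ⟨(i, j), rfl⟩
  constructor
  · intro f a ha
    suffices h : F ⊔ G ≤ (F ⊔ G).comap (hitL f) from h ha
    refine sup_le (fun x hx => Submodule.mem_sup_left (hF.smul_mem f x hx))
      (Submodule.span_le.mpr ?_)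
    rintro _ ⟨⟨i, j⟩, rfl⟩
    have := Submodule.add_mem_sup (hL f i j)
      (G.sum_mem fun l (_ : l ∈ Finset.univ) => G.smul_mem (f.toForm (TX l j)) (hZ i l))
    rwa [sub_add_cancel] at this
  · intro f a ha
    suffices h : F ⊔ G ≤ (F ⊔ G).comap (hitR f) from h ha
    refine sup_le (fun x hx => Submodule.mem_sup_left (hF.hitR_mem f x hx))
      (Submodule.span_le.mpr ?_)
    rintro _ ⟨⟨i, j⟩, rfl⟩
    have := Submodule.add_mem_sup (hR f i j)
      (G.sum_mem fun l (_ : l ∈ Finset.univ) => G.smul_mem (f.toForm (TY i l)) (hZ l j))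
    rwa [sub_add_cancel] at this

end Cotriangular

namespace Cotriangular

variable {u u' : ConvDual k A}

/-- `V` has sign `s` if `s tr(u|_V) = dim V`. -/
def HasSign (u : ConvDual k A) (s : k) (V : Type u) [AddCommGroup V] [Module k V]
    [Module (ConvDual k A) V] [IsScalarTower k (ConvDual k A) V] : Prop :=
  traceOn V (1 - s • u) = 0

section

variable {V : Type u} [AddCommGroup V] [Module k V] [Module (ConvDual k A) V]
  [IsScalarTower k (ConvDual k A) V] [IsRational k A V] [FiniteDimensional k V]
  {W : Type u} [AddCommGroup W] [Module k W] [Module (ConvDual k A) W]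
  [IsScalarTower k (ConvDual k A) W] [IsRational k A W] [FiniteDimensional k W]

omit [IsRational k A V] in
theorem hasSign_iff {s : k} : HasSign u s V ↔ s * traceOn V u = Module.finrank k V := by
  rw [HasSign, traceOn_sub, traceOn_one, traceOn_smul, sub_eq_zero, eq_comm]

omit [IsRational k A V] in
theorem HasSign.finrank_eq_zero [CharZero k] {s : k} (h : HasSign u s V)
    (h' : HasSign u (-s) V) : Module.finrank k V = 0 := by
  rw [hasSign_iff] at h h'
  have : (Module.finrank k V : k) = 0 := by
    have h2 : (2 : k) * Module.finrank k V = 0 := by linear_combination -h - h'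
    simpa using h2
  exact_mod_cast this

theorem IsPseudoUnit.traceOn_mul_self [IsAlgClosed k] (hu : IsPseudoUnit u u')
    [IsSimpleModule (ConvDual k A) V] :
    traceOn V u * traceOn V u = Module.finrank k V * Module.finrank k V := by
  let b := Module.finBasis k V
  have h0 : IsBistable (⊥ : Submodule k A) :=
    ⟨fun f a ha => by simp_all, fun f a ha => by simp_all⟩
  have hmul := isMult_coefMat (A := A) b
  have hL (f : ConvDual k A) (i j) :
      f • coefMat b i j - ∑ l, f.toForm (coefMat b l j) • coefMat b i l ∈ (⊥ : Submodule k A) := by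
    rw [Submodule.mem_bot, sub_eq_zero]
    refine eq_of_forall_form (k := k) fun g => ?_
    have := congr_fun (congr_fun (hmul.evalMat_mul g f) i) j
    simpa [apply_smul, Matrix.mul_apply, mul_comm] using this
  have hR (f : ConvDual k A) (i j) :
      hitR f (coefMat b i j) - ∑ l, f.toForm (coefMat b i l) • coefMat b l j ∈
        (⊥ : Submodule k A) := by
    rw [Submodule.mem_bot, sub_eq_zero]
    refine eq_of_forall_form (k := k) fun g => ?_
    have := congr_fun (congr_fun (hmul.evalMat_mul f g) i) j
    simpa [apply_hitR, Matrix.mul_apply, mul_comm] using this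
  have := hu.dichotomy h0 (coefMat b) (h0.sup_span _ _ _ hL hR) (coefMat b) (coefMat b) hmul
    (exists_evalMat_coefMat_eq b) (exists_evalMat_coefMat_eq b) hL hR
  rcases this with h | h
  · exfalso
    have hpos := finrank_pos_of_isSimpleModule (k := k) (A := A) (V := V)
    have h1 := hmul.counit ⟨0, hpos⟩ ⟨0, hpos⟩
    rw [(Submodule.mem_bot k).mp (h _ _)] at h1
    simp at h1
  · rwa [← traceOn_eq_trace_evalMat] at h

theorem IsPseudoUnit.exists_sign [IsAlgClosed k] (hu : IsPseudoUnit u u')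
    [IsSimpleModule (ConvDual k A) V] {s : k} (hs : s * s = 1) :
    HasSign u s V ∨ HasSign u (-s) V := by
  have h := hu.traceOn_mul_self (V := V)
  rw [hasSign_iff, hasSign_iff]
  have : (s * traceOn V u - Module.finrank k V) * (-s * traceOn V u - Module.finrank k V) = 0 := by
    linear_combination (-1) * h - (traceOn V u) ^ 2 * hs
  rcases mul_eq_zero.mp this with h | h
  · exact .inl (sub_eq_zero.mp h)
  · exact .inr (sub_eq_zero.mp h)

theorem IsPseudoUnit.exists_traceOn_eq [IsAlgClosed k] (hu : IsPseudoUnit u u') {s : k}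
    (hs : s * s = 1) (V : Type u) [AddCommGroup V] [Module k V] [Module (ConvDual k A) V]
    [IsScalarTower k (ConvDual k A) V] [IsRational k A V] [FiniteDimensional k V] :
    ∃ q : ℕ, traceOn V (1 - s • u) = (q : k) := by
  let S : AddSubmonoid k := AddMonoidHom.mrange (Nat.castAddMonoidHom k)
  have key : traceOn V (1 - s • u) ∈ S := by
    refine traceOn_mem_of_isSimpleModule S _ (fun V _ _ _ _ _ _ _ => ?_) V
    rcases hu.exists_sign (V := V) hs with h | h
    · exact ⟨0, by rw [map_zero, h]⟩
    · refine ⟨2 * Module.finrank k V, ?_⟩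
      rw [hasSign_iff] at h
      rw [traceOn_sub, traceOn_one, traceOn_smul]
      push_cast [Nat.coe_castAddMonoidHom]
      linear_combination -h
  obtain ⟨q, hq⟩ := key
  exact ⟨q, hq.symm⟩

theorem IsPseudoUnit.hasSign_iff_sub_quotient [IsAlgClosed k] [CharZero k]
    (hu : IsPseudoUnit u u') {s : k} (hs : s * s = 1) (N : Submodule (ConvDual k A) V) :
    HasSign u s V ↔ HasSign u s N ∧ HasSign u s (V ⧸ N) := by
  rw [HasSign, HasSign, HasSign, traceOn_eq_add N]
  obtain ⟨p, hp⟩ := hu.exists_traceOn_eq hs N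
  obtain ⟨q, hq⟩ := hu.exists_traceOn_eq hs (V ⧸ N)
  rw [hp, hq]
  norm_cast
  omega

omit [IsRational k A V] [IsRational k A W] [FiniteDimensional k V] [FiniteDimensional k W] in
theorem HasSign.congr {s : k} (h : HasSign u s V) (e : V ≃ₗ[ConvDual k A] W) :
    HasSign u s W := by
  rwa [HasSign, ← traceOn_congr e]

variable [IsAlgClosed k] [CharZero k]

omit [IsRational k A W] [FiniteDimensional k W] in
theorem IsPseudoUnit.hasSign_of_surjective (hu : IsPseudoUnit u u') {s : k} (hs : s * s = 1)
    (h : HasSign u s V) (g : V →ₗ[ConvDual k A] W) (hg : Function.Surjective g) :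
    HasSign u s W :=
  ((hu.hasSign_iff_sub_quotient hs (LinearMap.ker g)).mp h).2.congr
    (g.quotKerEquivOfSurjective hg)

omit [IsRational k A V] [FiniteDimensional k V] in
theorem IsPseudoUnit.hasSign_of_injective (hu : IsPseudoUnit u u') {s : k} (hs : s * s = 1)
    (h : HasSign u s W) (g : V →ₗ[ConvDual k A] W) (hg : Function.Injective g) :
    HasSign u s V :=
  ((hu.hasSign_iff_sub_quotient hs (LinearMap.range g)).mp h).1.congr
    (LinearEquiv.ofInjective g hg).symm

omit [IsAlgClosed k] [CharZero k] [IsRational k A V] [FiniteDimensional k V] in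
instance finiteDimensional_sup (N M : Submodule (ConvDual k A) V) [FiniteDimensional k N]
    [FiniteDimensional k M] : FiniteDimensional k ↥(N ⊔ M) := by
  let g : (N × M) →ₗ[ConvDual k A] ↥(N ⊔ M) :=
    (Submodule.inclusion le_sup_left).coprod (Submodule.inclusion le_sup_right)
  refine .of_surjective (g.restrictScalars k) ?_
  rintro ⟨x, hx⟩
  obtain ⟨a, ha, b, hb, rfl⟩ := Submodule.mem_sup.mp hx
  exact ⟨(⟨a, ha⟩, ⟨b, hb⟩), rfl⟩

omit [FiniteDimensional k V] in
theorem IsPseudoUnit.hasSign_sup (hu : IsPseudoUnit u u') {s : k} (hs : s * s = 1)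
    (N M : Submodule (ConvDual k A) V) [FiniteDimensional k N] [FiniteDimensional k M]
    (hN : HasSign u s N) (hM : HasSign u s M) : HasSign u s ↥(N ⊔ M) := by
  let i := Submodule.inclusion (le_sup_left : N ≤ N ⊔ M)
  rw [hu.hasSign_iff_sub_quotient hs (LinearMap.range i)]
  refine ⟨hN.congr (LinearEquiv.ofInjective i (Submodule.inclusion_injective _)), ?_⟩
  refine hu.hasSign_of_surjective hs hM
    ((LinearMap.range i).mkQ ∘ₗ Submodule.inclusion (le_sup_right : M ≤ N ⊔ M)) ?_
  intro x
  obtain ⟨⟨y, hy⟩, rfl⟩ := Submodule.mkQ_surjective _ x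
  obtain ⟨a, ha, b, hb, rfl⟩ := Submodule.mem_sup.mp hy
  refine ⟨⟨b, hb⟩, ?_⟩
  rw [LinearMap.comp_apply, Submodule.mkQ_apply, Submodule.mkQ_apply, Submodule.Quotient.eq]
  exact ⟨-⟨a, ha⟩, Subtype.ext (by simp [i])⟩

end

section SignPart

variable [IsAlgClosed k] [CharZero k]

/-- The part of `A` consisting of the coefficients of modules of sign `s`. -/
def IsPseudoUnit.signPart (hu : IsPseudoUnit u u') {s : k} (hs : s * s = 1) :
    Submodule (ConvDual k A) A where
  carrier := {a | HasSign u s (Submodule.span (ConvDual k A) {a})}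
  zero_mem' := by
    have : Subsingleton (Submodule.span (ConvDual k A) {(0 : A)}) := by
      rw [Submodule.span_zero_singleton]
      infer_instance
    exact traceOn_of_subsingleton _
  add_mem' {a b} ha hb := by
    let N := Submodule.span (ConvDual k A) {a} ⊔ Submodule.span (ConvDual k A) {b}
    have hle : Submodule.span (ConvDual k A) {a + b} ≤ N := by
      rw [Submodule.span_singleton_le_iff_mem]
      exact Submodule.add_mem_sup (Submodule.mem_span_singleton_self a)
        (Submodule.mem_span_singleton_self b)
    exact hu.hasSign_of_injective hs (hu.hasSign_sup hs _ _ ha hb) (Submodule.inclusion hle)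
      (Submodule.inclusion_injective hle)
  smul_mem' f a ha := by
    have hle : Submodule.span (ConvDual k A) {f • a} ≤ Submodule.span (ConvDual k A) {a} := by
      rw [Submodule.span_singleton_le_iff_mem]
      exact Submodule.smul_mem _ _ (Submodule.mem_span_singleton_self a)
    exact hu.hasSign_of_injective hs ha (Submodule.inclusion hle)
      (Submodule.inclusion_injective hle)

variable {V : Type u} [AddCommGroup V] [Module k V] [Module (ConvDual k A) V]
  [IsScalarTower k (ConvDual k A) V] [IsRational k A V] [FiniteDimensional k V]
  (hu : IsPseudoUnit u u') {s : k} (hs : s * s = 1)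

include hs in
theorem IsPseudoUnit.apply_mem_signPart (h : HasSign u s V) (g : V →ₗ[ConvDual k A] A) (v : V) :
    g v ∈ hu.signPart hs := by
  have : FiniteDimensional k (LinearMap.range g) :=
    .of_surjective (g.rangeRestrict.restrictScalars k) g.surjective_rangeRestrict
  have hle : Submodule.span (ConvDual k A) {g v} ≤ LinearMap.range g := by
    rw [Submodule.span_singleton_le_iff_mem]
    exact LinearMap.mem_range_self g v
  exact hu.hasSign_of_injective hs
    (hu.hasSign_of_surjective hs h g.rangeRestrict g.surjective_rangeRestrict)
    (Submodule.inclusion hle) (Submodule.inclusion_injective hle)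

theorem IsPseudoUnit.coef_mem_signPart (h : HasSign u s V) (φ : V →ₗ[k] k) (v : V) :
    coef A φ v ∈ hu.signPart hs :=
  hu.apply_mem_signPart hs h (coefHom φ) v

theorem IsPseudoUnit.hitR_mem_signPart (f : ConvDual k A) {a : A} (ha : a ∈ hu.signPart hs) :
    hitR f a ∈ hu.signPart hs := by
  let g : A →ₗ[ConvDual k A] A := { hitR f with map_smul' := fun h b => hitR_smul f h b }
  exact hu.apply_mem_signPart hs ha (g ∘ₗ Submodule.subtype _)
    ⟨a, Submodule.mem_span_singleton_self a⟩

theorem IsPseudoUnit.disjoint_signPart (hs' : (-s) * (-s) = 1) :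
    Disjoint (hu.signPart hs) (hu.signPart hs') := by
  rw [Submodule.disjoint_def]
  intro a ha ha'
  have h := HasSign.finrank_eq_zero ha ha'
  have := Module.finrank_zero_iff.mp h
  exact congrArg Subtype.val (Subsingleton.elim
    (⟨a, Submodule.mem_span_singleton_self a⟩ : Submodule.span (ConvDual k A) {a}) 0)

theorem IsPseudoUnit.hasSign_of_coef_mem (V : Type u) [AddCommGroup V] [Module k V]
    [Module (ConvDual k A) V] [IsScalarTower k (ConvDual k A) V] [IsRational k A V]
    [FiniteDimensional k V] (h : ∀ (φ : V →ₗ[k] k) v, coef A φ v ∈ hu.signPart hs) :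
    HasSign u s V := by
  induction hd : Module.finrank k V using Nat.strong_induction_on generalizing V with
  | _ d ih =>
    rcases subsingleton_or_nontrivial V with hV | hV
    · exact traceOn_of_subsingleton _
    · obtain ⟨N, -, hN⟩ := exists_isSimpleModule_le (⊤ : Submodule (ConvDual k A) V) top_ne_bot
      have h1 := finrank_eq_add N
      have h2 := finrank_pos_of_isSimpleModule (k := k) (A := A) (V := N)
      rw [hu.hasSign_iff_sub_quotient hs N]
      constructor
      · have := IsSimpleModule.nontrivial (ConvDual k A) N
        obtain ⟨y, hy⟩ := exists_ne (0 : N)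
        obtain ⟨φ, hφ⟩ : ∃ φ : N →ₗ[k] k, φ y ≠ 0 := by
          by_contra! hc
          exact hy ((Module.forall_dual_apply_eq_zero_iff k y).mp hc)
        have hg0 : coefHom (A := A) φ ≠ 0 := fun hc => hφ (by
          rw [← counit_coef (A := A), ← coefHom_apply, hc]; simp)
        have hspan (x : N) : coefHom (A := A) φ x ∈ Submodule.span (ConvDual k A) {coef A φ y} := by
          have hx : x ∈ Submodule.span (ConvDual k A) {y} := by
            rw [IsSimpleModule.span_singleton_eq_top (ConvDual k A) hy]; trivial
          obtain ⟨f, rfl⟩ := Submodule.mem_span_singleton.mp hx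
          exact Submodule.mem_span_singleton.mpr ⟨f, by rw [map_smul]; rfl⟩
        have hmem : coef A φ y ∈ hu.signPart hs := by
          obtain ⟨ψ, rfl⟩ := exists_coef_submodule N φ
          rw [coef_submodule]
          exact h _ _
        refine hu.hasSign_of_injective hs hmem ((coefHom φ).codRestrict _ hspan) ?_
        intro x x' hxx
        exact (LinearMap.injective_or_eq_zero (coefHom (A := A) φ)).resolve_right hg0
          (congrArg Subtype.val hxx)
      · refine ih _ (by omega) (V ⧸ N) (fun φ v => ?_) rfl
        obtain ⟨v, rfl⟩ := N.mkQ_surjective v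
        rw [coef_quotient]
        exact h _ _

end SignPart

end Cotriangular

namespace Cotriangular

variable {u u' : ConvDual k A} [IsAlgClosed k] [CharZero k]

section

variable {V : Type u} [AddCommGroup V] [Module k V] [Module (ConvDual k A) V]
  [IsScalarTower k (ConvDual k A) V] [IsRational k A V] [FiniteDimensional k V]

omit [IsAlgClosed k] [CharZero k] [IsRational k A V] [FiniteDimensional k V] in
theorem HasSign.traceOn_eq {s : k} (hs : s * s = 1) [FiniteDimensional k V]
    (h : HasSign u s V) : traceOn V u = s * Module.finrank k V := by
  rw [hasSign_iff] at h
  rw [← h, ← mul_assoc, hs, one_mul]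

/-- If the top `V ⧸ M` and a simple submodule `Y ≤ M` have opposite signs, then the coefficients of
`V` are combinations of those of `M` and of `V ⧸ Y`. -/
theorem IsPseudoUnit.coef_mem_of_opposite (hu : IsPseudoUnit u u') {s : k} (hs : s * s = 1)
    (B : Submodule k A) {M Y : Submodule (ConvDual k A) V}
    [IsSimpleModule (ConvDual k A) Y] [IsSimpleModule (ConvDual k A) (V ⧸ M)]
    (hX : HasSign u s (V ⧸ M)) (hY : HasSign u (-s) Y)
    (hBM : ∀ φ : V →ₗ[k] k, ∀ v ∈ M, coef A φ v ∈ B)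
    (hBY : ∀ φ : V →ₗ[k] k, (∀ y ∈ Y, φ y = 0) → ∀ v, coef A φ v ∈ B)
    (φ : V →ₗ[k] k) (v : V) : coef A φ v ∈ B := by
  let bY := Module.finBasis k Y
  let bX := Module.finBasis k (V ⧸ M)
  choose l hl using fun i => exists_coef_submodule Y (bY.coord i)
  choose x hx using fun j => M.mkQ_surjective (bX j)
  have hl' (i) (y : Y) : l i y = bY.repr y i := LinearMap.congr_fun (hl i) y
  let P : (V →ₗ[k] k) → V → Prop := fun φ v => v ∈ M ∨ ∀ y ∈ Y, φ y = 0
  let F : Submodule k A := Submodule.span k {a : A | ∃ φ v, P φ v ∧ coef A φ v = a}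
  have hFfd : FiniteDimensional k F := finiteDimensional_span_coef P
  have hF : IsBistable F := by
    refine isBistable_span_coef P ?_ ?_
    · rintro φ v f (h | h)
      · exact .inl (M.smul_mem f h)
      · exact .inr h
    · rintro φ v f (h | h)
      · exact .inl h
      · exact .inr fun y hy => h _ (Y.smul_mem f hy)
  have hFB : F ≤ B := by
    refine Submodule.span_le.mpr ?_
    rintro _ ⟨φ, v, h | h, rfl⟩
    · exact hBM φ v h
    · exact hBY φ h v
  have hv (v : V) : v - ∑ j, bX.repr (M.mkQ v) j • x j ∈ M := by
    refine (Submodule.Quotient.mk_eq_zero M).mp ?_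
    change M.mkQ _ = 0
    rw [map_sub, sub_eq_zero]
    conv_lhs => rw [← bX.sum_repr (M.mkQ v)]
    have h1 := map_sum (M.mkQ.restrictScalars k) (fun j => bX.repr (M.mkQ v) j • x j) Finset.univ
    refine Eq.trans ?_ h1.symm
    refine Finset.sum_congr rfl fun j _ => ?_
    rw [map_smul, ← hx]
    rfl
  let Z : Matrix (Fin (Module.finrank k Y)) (Fin (Module.finrank k (V ⧸ M))) A :=
    fun i j => coef A (l i) (x j)
  have hL (f : ConvDual k A) (i j) :
      f • Z i j - ∑ p, f.toForm (coefMat bX p j) • Z i p ∈ F := by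
    have hw : f • x j - ∑ p, f.toForm (coefMat bX p j) • x p ∈ M := by
      have hc (p) : f.toForm (coefMat bX p j) = bX.repr (M.mkQ (f • x j)) p := by
        rw [coefMat, apply_coef, M.mkQ.map_smul, hx]
        rfl
      simp only [hc]
      exact hv _
    have : f • Z i j - ∑ p, f.toForm (coefMat bX p j) • Z i p =
        coef A (l i) (f • x j - ∑ p, f.toForm (coefMat bX p j) • x p) := by
      simp only [coef_sub, coef_smul, coef_sum, coef_smul_right, Z]
    rw [this]
    exact Submodule.subset_span ⟨_, _, .inl hw, rfl⟩
  have hR (f : ConvDual k A) (i j) :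
      hitR f (Z i j) - ∑ p, f.toForm (coefMat bY i p) • Z p j ∈ F := by
    have hw : ∀ y ∈ Y, (l i ∘ₗ Algebra.lsmul k k V f -
        ∑ p, f.toForm (coefMat bY i p) • l p) y = 0 := by
      intro y hy
      have h1 : l i (f • y) = bY.repr (f • ⟨y, hy⟩) i := hl' i (f • ⟨y, hy⟩)
      have h2 (p) : l p y = bY.repr ⟨y, hy⟩ p := hl' p ⟨y, hy⟩
      have h3 : bY.repr (f • ⟨y, hy⟩) i =
          ∑ p, bY.repr ⟨y, hy⟩ p * bY.repr (f • bY p) i := by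
        have := congrArg (fun z => bY.coord i (Algebra.lsmul k k Y f z)) (bY.sum_repr ⟨y, hy⟩)
        simp only [map_sum, map_smul] at this
        exact this.symm
      change l i (f • y) - (∑ p, f.toForm (coefMat bY i p) • l p) y = 0
      rw [h1, h3, LinearMap.sum_apply, sub_eq_zero]
      refine Finset.sum_congr rfl fun p _ => ?_
      rw [LinearMap.smul_apply, h2, smul_eq_mul, mul_comm, coefMat, apply_coef]
      rfl
    have : hitR f (Z i j) - ∑ p, f.toForm (coefMat bY i p) • Z p j =
        coef A (l i ∘ₗ Algebra.lsmul k k V f - ∑ p, f.toForm (coefMat bY i p) • l p) (x j) := by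
      simp only [coef_sub_left, hitR_coef, coef_sum_left, coef_smul_left, Z]
    rw [this]
    exact Submodule.subset_span ⟨_, _, .inr hw, rfl⟩
  have hZ : ∀ i j, Z i j ∈ F := by
    refine (hu.dichotomy hF Z (hF.sup_span _ _ _ hL hR) (coefMat bY) (coefMat bX)
      (isMult_coefMat bX) (exists_evalMat_coefMat_eq bY) (exists_evalMat_coefMat_eq bX)
      hL hR).resolve_right fun h => ?_
    rw [← traceOn_eq_trace_evalMat, ← traceOn_eq_trace_evalMat, hX.traceOn_eq hs,
      hY.traceOn_eq (by linear_combination hs)] at h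
    have hm := finrank_pos_of_isSimpleModule (k := k) (A := A) (V := Y)
    have hn := finrank_pos_of_isSimpleModule (k := k) (A := A) (V := V ⧸ M)
    have h0 : (2 : k) * (Module.finrank k Y * Module.finrank k (V ⧸ M)) = 0 := by
      linear_combination -h - (Module.finrank k Y : k) * Module.finrank k (V ⧸ M) * hs
    simp at h0
    omega
  have hφ : ∀ y ∈ Y, (φ - ∑ i, φ (bY i : V) • l i) y = 0 := by
    intro y hy
    have h2 (p) : l p y = bY.repr ⟨y, hy⟩ p := hl' p ⟨y, hy⟩
    have := congrArg (φ ∘ₗ Y.subtype.restrictScalars k) (bY.sum_repr ⟨y, hy⟩)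
    simp only [map_sum, map_smul] at this
    rw [LinearMap.sub_apply, sub_eq_zero]
    refine this.symm.trans ?_
    simp [h2, mul_comm]
  rw [← sub_add_cancel v (∑ j, bX.repr (M.mkQ v) j • x j), coef_add]
  refine B.add_mem (hBM _ _ (hv v)) ?_
  rw [coef_sum]
  refine B.sum_mem fun j _ => ?_
  rw [coef_smul_right]
  refine B.smul_mem _ ?_
  rw [← sub_add_cancel φ (∑ i, φ (bY i : V) • l i), coef_add_left]
  refine B.add_mem (hBY _ hφ _) ?_
  rw [coef_sum_left]
  refine B.sum_mem fun i _ => ?_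
  rw [coef_smul_left]
  exact B.smul_mem _ (hFB (hZ i j))

end

omit [IsAlgClosed k] [CharZero k] in
theorem exists_form (P Q : Submodule (ConvDual k A) A) (h : Disjoint P Q) (α β : k) :
    ∃ c : ConvDual k A, (∀ a ∈ P, c.toForm a = α * Coalgebra.counit (R := k) a) ∧
      ∀ a ∈ Q, c.toForm a = β * Coalgebra.counit (R := k) a := by
  let p : Submodule k A := P.restrictScalars k
  let q : Submodule k A := Q.restrictScalars k
  have hpq : Disjoint p q := by
    rw [Submodule.disjoint_def] at h ⊢
    exact h
  obtain ⟨q', hq, hc⟩ := hpq.exists_isCompl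
  have hl (a : A) (ha : a ∈ p) : q'.projection q hc a = a :=
    Submodule.projection_apply_left hc ⟨a, hq ha⟩
  have hr (a : A) (ha : a ∈ q) : q'.projection q hc a = 0 :=
    Submodule.projection_apply_right hc ⟨a, ha⟩
  refine ⟨.ofForm ((α - β) • Coalgebra.counit ∘ₗ q'.projection q hc + β • Coalgebra.counit),
    fun a ha => ?_, fun a ha => ?_⟩
  · simp only [toForm_ofForm, LinearMap.add_apply, LinearMap.smul_apply, LinearMap.comp_apply,
      hl a ha, smul_eq_mul]
    ring
  · simp only [toForm_ofForm, LinearMap.add_apply, LinearMap.smul_apply, LinearMap.comp_apply,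
      hr a ha, smul_eq_mul, map_zero]
    ring

end Cotriangular

namespace Cotriangular

variable {u u' : ConvDual k A} [IsAlgClosed k] [CharZero k]

section

variable {V : Type u} [AddCommGroup V] [Module k V] [Module (ConvDual k A) V]
  [IsScalarTower k (ConvDual k A) V] [IsRational k A V] [FiniteDimensional k V]

theorem IsPseudoUnit.smul_eq_of_form (hu : IsPseudoUnit u u') {s : k} (hs : s * s = 1)
    {c : ConvDual k A} {α : k}
    (h : ∀ a ∈ hu.signPart hs, c.toForm a = α * Coalgebra.counit (R := k) a)
    {a : A} (ha : a ∈ hu.signPart hs) : c • a = α • a :=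
  eq_of_forall_form (k := k) fun g => by
    rw [apply_smul, ← apply_hitR, h _ (hu.hitR_mem_signPart hs g ha), ← one_apply_eq, apply_hitR,
      mul_one, map_smul, smul_eq_mul]

theorem IsPseudoUnit.hitR_eq_of_form (hu : IsPseudoUnit u u') {s : k} (hs : s * s = 1)
    {c : ConvDual k A} {α : k}
    (h : ∀ a ∈ hu.signPart hs, c.toForm a = α * Coalgebra.counit (R := k) a)
    {a : A} (ha : a ∈ hu.signPart hs) : hitR c a = α • a :=
  eq_of_forall_form (k := k) fun g => by
    rw [apply_hitR, ← apply_smul, h _ (Submodule.smul_mem _ g ha), ← one_apply_eq, apply_smul,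
      one_mul, map_smul, smul_eq_mul]

theorem IsPseudoUnit.coef_mem_sup_of_top (hu : IsPseudoUnit u u') {s t : k} (hs : s * s = 1)
    (ht : t * t = 1) (hst : t = -s) {M : Submodule (ConvDual k A) V}
    [IsSimpleModule (ConvDual k A) (V ⧸ M)] (hX : HasSign u s (V ⧸ M))
    (hM : ∀ (φ : M →ₗ[k] k) v, coef A φ v ∈ hu.signPart hs ⊔ hu.signPart ht)
    (hQ : ∀ Y : Submodule (ConvDual k A) V, IsSimpleModule (ConvDual k A) Y →
      ∀ (φ : V ⧸ Y →ₗ[k] k) v, coef A φ v ∈ hu.signPart hs ⊔ hu.signPart ht)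
    (φ : V →ₗ[k] k) (v : V) : coef A φ v ∈ hu.signPart hs ⊔ hu.signPart ht := by
  subst hst
  by_cases hY : ∃ Y : Submodule (ConvDual k A) V, IsSimpleModule (ConvDual k A) Y ∧
    HasSign u (-s) Y
  · obtain ⟨Y, hY, hsY⟩ := hY
    refine hu.coef_mem_of_opposite (M := M) (Y := Y) hs
      ((hu.signPart hs ⊔ hu.signPart ht).restrictScalars k) hX hsY (fun φ v hv => ?_)
      (fun φ h v => ?_) φ v
    · exact coef_submodule M φ ⟨v, hv⟩ ▸ hM _ _
    · let ψ : V ⧸ Y →ₗ[k] k := (Y.restrictScalars k).liftQ φ h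
      exact coef_quotient Y ψ v ▸ hQ Y hY ψ (Y.mkQ v)
  · have hsimple (Y : Submodule (ConvDual k A) V) (h : IsSimpleModule (ConvDual k A) Y) :
        ¬ HasSign u (-s) Y := fun h' => hY ⟨Y, h, h'⟩
    obtain ⟨e, he0, he1⟩ := exists_form _ _ (hu.disjoint_signPart hs ht) 0 1
    have hcoef (v : V) (hv : v ∈ M) (φ : V →ₗ[k] k) (h : ConvDual k A) :
        coef A φ (h • e • v) ∈ hu.signPart ht := by
      rw [coef_smul, coef_smul]
      refine Submodule.smul_mem _ h ?_
      rw [show coef A φ v = coef A (φ ∘ₗ M.subtype.restrictScalars k) (⟨v, hv⟩ : M) from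
        (coef_submodule M φ ⟨v, hv⟩).symm]
      obtain ⟨a, ha, b, hb, hab⟩ := Submodule.mem_sup.mp
        (hM (φ ∘ₗ M.subtype.restrictScalars k) ⟨v, hv⟩)
      rw [← hab, smul_add, hu.smul_eq_of_form hs he0 ha, hu.smul_eq_of_form ht he1 hb]
      simpa using hb
    have hev (v : V) (hv : v ∈ M) : e • v = 0 := by
      let N := Submodule.span (ConvDual k A) {e • v}
      have hN : HasSign u (-s) N := by
        refine hu.hasSign_of_coef_mem ht N fun φ w => ?_
        obtain ⟨ψ, rfl⟩ := exists_coef_submodule N φ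
        obtain ⟨w, hw⟩ := w
        obtain ⟨h, rfl⟩ := Submodule.mem_span_singleton.mp hw
        rw [coef_submodule]
        exact hcoef v hv ψ h
      by_contra h0
      have hN0 : N ≠ ⊥ := by simpa [N, Submodule.span_singleton_eq_bot] using h0
      obtain ⟨Y, hYN, hYs⟩ := exists_isSimpleModule_le N hN0
      exact hsimple Y hYs (hu.hasSign_of_injective ht hN (Submodule.inclusion hYN)
        (Submodule.inclusion_injective _))
    have hMs : HasSign u s M := by
      refine hu.hasSign_of_coef_mem hs M fun φ v => ?_
      obtain ⟨a, ha, b, hb, hab⟩ := Submodule.mem_sup.mp (hM φ v)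
      have h0 : e • coef A φ v = 0 := by
        have hv0 : e • v = 0 := Subtype.ext (hev v v.2)
        rw [← coef_smul, hv0]
        exact map_zero (coefHom φ)
      rw [← hab, smul_add, hu.smul_eq_of_form hs he0 ha, hu.smul_eq_of_form ht he1 hb, zero_smul,
        one_smul, zero_add] at h0
      rw [← hab, h0, add_zero]
      exact ha
    exact Submodule.mem_sup_left (hu.coef_mem_signPart hs
      ((hu.hasSign_iff_sub_quotient hs M).mpr ⟨hMs, hX⟩) φ v)

end

theorem IsPseudoUnit.coef_mem_sup (hu : IsPseudoUnit u u') {s t : k} (hs : s * s = 1)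
    (ht : t * t = 1) (hst : t = -s) (V : Type u) [AddCommGroup V] [Module k V]
    [Module (ConvDual k A) V] [IsScalarTower k (ConvDual k A) V] [IsRational k A V]
    [FiniteDimensional k V] (φ : V →ₗ[k] k) (v : V) :
    coef A φ v ∈ hu.signPart hs ⊔ hu.signPart ht := by
  induction hd : Module.finrank k V using Nat.strong_induction_on generalizing V with
  | _ d ih =>
    rcases subsingleton_or_nontrivial V with hV | hV
    · rw [Subsingleton.elim v 0]
      have h0 : coef A φ (0 : V) = 0 := (coefHom φ).map_zero
      exact h0 ▸ Submodule.zero_mem _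
    · obtain ⟨M, hMs⟩ := exists_isSimpleModule_quotient (k := k) (A := A) (V := V)
      have hM (φ : M →ₗ[k] k) (v : M) : coef A φ v ∈ hu.signPart hs ⊔ hu.signPart ht := by
        refine ih _ ?_ M φ v rfl
        have := finrank_eq_add (k := k) M
        have := finrank_pos_of_isSimpleModule (k := k) (A := A) (V := V ⧸ M)
        omega
      have hQ (Y : Submodule (ConvDual k A) V) (hY : IsSimpleModule (ConvDual k A) Y)
          (φ : V ⧸ Y →ₗ[k] k) (v) : coef A φ v ∈ hu.signPart hs ⊔ hu.signPart ht := by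
        refine ih _ ?_ (V ⧸ Y) φ v rfl
        have := finrank_eq_add (k := k) Y
        have := finrank_pos_of_isSimpleModule (k := k) (A := A) (V := Y)
        omega
      rcases hu.exists_sign (V := V ⧸ M) hs with h | h
      · exact hu.coef_mem_sup_of_top hs ht hst h hM hQ φ v
      · rw [sup_comm] at hM ⊢
        simp only [sup_comm (hu.signPart hs)] at hQ
        rw [← hst] at h
        exact hu.coef_mem_sup_of_top ht hs (by rw [hst, neg_neg]) h hM hQ φ v

theorem IsPseudoUnit.mem_sup (hu : IsPseudoUnit u u') {s t : k} (hs : s * s = 1)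
    (ht : t * t = 1) (hst : t = -s) (a : A) : a ∈ hu.signPart hs ⊔ hu.signPart ht := by
  have := finiteDimensional_span (k := k) a
  let b := Module.finBasis k (Submodule.span (ConvDual k A) {a})
  refine (Submodule.span_le (p := (hu.signPart hs ⊔ hu.signPart ht).restrictScalars k)).mpr ?_
    (mem_span_coefMat _ b a (Submodule.mem_span_singleton_self a))
  rintro _ ⟨⟨i, j⟩, rfl⟩
  exact hu.coef_mem_sup hs ht hst _ _ _

end Cotriangular

namespace Cotriangular

section Rep

variable {ι : Type} [Fintype ι] [DecidableEq ι] {T : Matrix ι ι A}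

/-- The `A*`-module `k^ι` attached to a multiplicative matrix. -/
def IsMult.Rep (_ : IsMult k T) : Type u := ι → k

variable (hT : IsMult k T)

instance : AddCommGroup hT.Rep := inferInstanceAs (AddCommGroup (ι → k))

instance : Module k hT.Rep := inferInstanceAs (Module k (ι → k))

instance : FiniteDimensional k hT.Rep := inferInstanceAs (FiniteDimensional k (ι → k))

instance : Module (ConvDual k A) hT.Rep where
  smul f v := (evalMat f T).mulVec v
  one_smul v := by
    change (evalMat 1 T).mulVec v = v
    rw [hT.evalMat_one]
    exact Matrix.one_mulVec _
  mul_smul f g v := by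
    change (evalMat (f * g) T).mulVec v = (evalMat f T).mulVec ((evalMat g T).mulVec v)
    rw [hT.evalMat_mul]
    exact (Matrix.mulVec_mulVec _ _ _).symm
  smul_zero f := Matrix.mulVec_zero _
  smul_add f v w := Matrix.mulVec_add _ v w
  add_smul f g v := Matrix.add_mulVec (evalMat f T) (evalMat g T) v
  zero_smul v := Matrix.zero_mulVec v

/-- The standard basis of `hT.Rep`. -/
def IsMult.repBasis : Module.Basis ι k hT.Rep := Pi.basisFun k ι

theorem IsMult.repBasis_coord_smul (f : ConvDual k A) (i j : ι) :
    hT.repBasis.coord i (f • hT.repBasis j) = f.toForm (T i j) := by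
  change (evalMat f T).mulVec (Pi.basisFun k ι j) i = f.toForm (T i j)
  rw [Pi.basisFun_apply, Matrix.mulVec_single_one]
  rfl

instance : IsScalarTower k (ConvDual k A) hT.Rep where
  smul_assoc c f v := Matrix.smul_mulVec c (evalMat f T) v

instance : IsRational k A hT.Rep where
  exists_coef φ v := by
    refine ⟨∑ i, ∑ j, (hT.repBasis.repr v j * φ (hT.repBasis i)) • T i j, fun f => ?_⟩
    have h1 : f • v = ∑ j, hT.repBasis.repr v j • f • hT.repBasis j := by
      have := congrArg (Algebra.lsmul k k hT.Rep f) (hT.repBasis.sum_repr v)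
      simp only [map_sum, map_smul] at this
      exact this.symm
    have h2 (j) : f • hT.repBasis j = ∑ i, f.toForm (T i j) • hT.repBasis i := by
      rw [← hT.repBasis.sum_repr (f • hT.repBasis j)]
      refine Finset.sum_congr rfl fun i _ => ?_
      rw [← hT.repBasis_coord_smul]
      rfl
    rw [h1]
    simp only [h2, map_sum, map_smul, Finset.smul_sum, smul_eq_mul]
    rw [Finset.sum_comm]
    refine Finset.sum_congr rfl fun j _ => Finset.sum_congr rfl fun i _ => ?_
    ring

theorem IsMult.coefMat_repBasis : coefMat (A := A) hT.repBasis = T := by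
  ext i j
  exact eq_of_forall_form (k := k) fun f => by
    rw [coefMat, apply_coef, hT.repBasis_coord_smul]

theorem IsMult.traceOn_rep (f : ConvDual k A) : traceOn hT.Rep f = (evalMat f T).trace := by
  rw [traceOn_eq_trace_evalMat hT.repBasis, hT.coefMat_repBasis]

theorem IsMult.finrank_rep : Module.finrank k hT.Rep = Fintype.card ι :=
  Module.finrank_eq_card_basis hT.repBasis

end Rep

open scoped Kronecker in
theorem IsMult.kronecker {ι κ : Type*} [Fintype ι] [DecidableEq ι] [Fintype κ] [DecidableEq κ]
    {T : Matrix ι ι A} {T' : Matrix κ κ A} (hT : IsMult k T) (hT' : IsMult k T') :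
    IsMult k (T ⊗ₖ T') where
  comul p q := by
    simp only [Matrix.kroneckerMap_apply, Bialgebra.comul_mul, hT.comul, hT'.comul,
      Finset.sum_mul_sum, Algebra.TensorProduct.tmul_mul_tmul, Fintype.sum_prod_type]
  counit p q := by
    simp only [Matrix.kroneckerMap_apply, Bialgebra.counit_mul, hT.counit, hT'.counit,
      Matrix.one_apply, Prod.ext_iff]
    split_ifs <;> simp_all

theorem isMult_one : IsMult k (1 : Matrix Unit Unit A) where
  comul i j := by simp [Algebra.TensorProduct.one_def]
  counit i j := by simp

variable {u u' : ConvDual k A} [IsAlgClosed k] [CharZero k]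

theorem IsPseudoUnit.apply_mem_of_trace (hu : IsPseudoUnit u u') {s : k} (hs : s * s = 1)
    {ι : Type} [Fintype ι] [DecidableEq ι] {T : Matrix ι ι A} (hT : IsMult k T)
    (h : s * (evalMat u T).trace = Fintype.card ι) (i j : ι) : T i j ∈ hu.signPart hs := by
  have hT' : HasSign u s hT.Rep := by rwa [hasSign_iff, hT.traceOn_rep, hT.finrank_rep]
  rw [← hT.coefMat_repBasis]
  exact hu.coef_mem_signPart hs hT' _ _

theorem IsPseudoUnit.one_mem_signPart (hu : IsPseudoUnit u u') {s : k} (hs : s * s = 1)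
    (hs1 : s = 1) (h1 : u.toForm 1 = 1) : (1 : A) ∈ hu.signPart hs :=
  hu.apply_mem_of_trace hs isMult_one (by simp [Matrix.trace, h1, hs1]) () ()

theorem IsPseudoUnit.mul_mem_signPart (hu : IsPseudoUnit u u')
    (hmul : ∀ a b, u.toForm (a * b) = u.toForm a * u.toForm b) {s t r : k} (hs : s * s = 1)
    (ht : t * t = 1) (hr : r * r = 1) (hst : s * t = r) {a b : A} (ha : a ∈ hu.signPart hs)
    (hb : b ∈ hu.signPart ht) : a * b ∈ hu.signPart hr := by
  have := finiteDimensional_span (k := k) a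
  have := finiteDimensional_span (k := k) b
  let ba := Module.finBasis k (Submodule.span (ConvDual k A) {a})
  let bb := Module.finBasis k (Submodule.span (ConvDual k A) {b})
  have h := Submodule.mul_mem_mul
    (mem_span_coefMat _ ba a (Submodule.mem_span_singleton_self a))
    (mem_span_coefMat _ bb b (Submodule.mem_span_singleton_self b))
  rw [Submodule.span_mul_span] at h
  refine (Submodule.span_le (p := (hu.signPart hr).restrictScalars k)).mpr ?_ h
  rintro _ ⟨_, ⟨⟨i, j⟩, rfl⟩, _, ⟨⟨i', j'⟩, rfl⟩, rfl⟩
  refine hu.apply_mem_of_trace hr ((isMult_coefMat ba).kronecker (isMult_coefMat bb)) ?_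
    (i, i') (j, j')
  have hka := hasSign_iff.mp ha
  have hkb := hasSign_iff.mp hb
  rw [traceOn_eq_trace_evalMat ba] at hka
  rw [traceOn_eq_trace_evalMat bb] at hkb
  have htr : (evalMat u (Matrix.kroneckerMap (· * ·) (coefMat ba) (coefMat bb))).trace =
      (evalMat u (coefMat ba)).trace * (evalMat u (coefMat bb)).trace := by
    simp [Matrix.trace, Fintype.sum_prod_type, hmul, Finset.sum_mul_sum]
  rw [htr, Fintype.card_prod, Fintype.card_fin, Fintype.card_fin, Nat.cast_mul, ← hka, ← hkb,
    ← hst]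
  ring

theorem IsPseudoUnit.exists_central (hu : IsPseudoUnit u u') (h1 : u.toForm 1 = 1)
    (hmul : ∀ a b, u.toForm (a * b) = u.toForm a * u.toForm b) :
    ∃ c : ConvDual k A, c.toForm 1 = 1 ∧
      (∀ a b, c.toForm (a * b) = c.toForm a * c.toForm b) ∧ (∀ f, c * f = f * c) ∧ c * c = 1 ∧
      ∀ (V : Type u) [AddCommGroup V] [Module k V] [Module (ConvDual k A) V]
        [IsScalarTower k (ConvDual k A) V] [IsRational k A V] [FiniteDimensional k V],
        traceOn V (u * c) = Module.finrank k V := by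
  have hp : (1 : k) * 1 = 1 := one_mul 1
  have hm : (-1 : k) * -1 = 1 := by simp
  obtain ⟨c, hcp, hcm⟩ := exists_form _ _ (hu.disjoint_signPart hp hm) 1 (-1)
  have hsup (a : A) : ∃ x ∈ hu.signPart hp, ∃ y ∈ hu.signPart hm, x + y = a :=
    Submodule.mem_sup.mp (hu.mem_sup hp hm rfl a)
  have hcomm (a : A) : hitR c a = c • a := by
    obtain ⟨x, hx, y, hy, rfl⟩ := hsup a
    rw [smul_add, map_add, hu.hitR_eq_of_form hp hcp hx, hu.hitR_eq_of_form hm hcm hy,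
      hu.smul_eq_of_form hp hcp hx, hu.smul_eq_of_form hm hcm hy]
  refine ⟨c, ?_, fun a b => ?_, fun f => ConvDual.ext_form fun a => ?_,
    ConvDual.ext_form fun a => ?_, fun V _ _ _ _ _ _ => ?_⟩
  · rw [hcp _ (hu.one_mem_signPart hp rfl h1)]
    simp
  · obtain ⟨x, hx, y, hy, rfl⟩ := hsup a
    obtain ⟨z, hz, w, hw, rfl⟩ := hsup b
    simp only [add_mul, mul_add, map_add,
      hcp _ (hu.mul_mem_signPart hmul hp hp hp (by simp) hx hz),
      hcm _ (hu.mul_mem_signPart hmul hp hm hm (by simp) hx hw),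
      hcm _ (hu.mul_mem_signPart hmul hm hp hm (by simp) hy hz),
      hcp _ (hu.mul_mem_signPart hmul hm hm hp (by simp) hy hw),
      hcp x hx, hcm y hy, hcp z hz, hcm w hw, Bialgebra.counit_mul]
    ring
  · rw [← apply_hitR, hcomm, apply_smul]
  · rw [← apply_smul]
    obtain ⟨x, hx, y, hy, rfl⟩ := hsup a
    rw [smul_add, hu.smul_eq_of_form hp hcp hx, hu.smul_eq_of_form hm hcm hy]
    simp [hcp x hx, hcm y hy, one_apply_eq]
  · have key : traceOn V (1 - u * c) ∈ (⊥ : AddSubmonoid k) := by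
      refine traceOn_mem_of_isSimpleModule ⊥ _ (fun V _ _ _ _ _ _ _ => ?_) V
      have haux {s : k} (hs : s * s = 1) (hsV : HasSign u s V)
          (hc : ∀ a ∈ hu.signPart hs, c.toForm a = s * Coalgebra.counit (R := k) a) :
          traceOn V (1 - u * c) = 0 := by
        have hcv (v : V) : c • v = s • v := by
          rw [← sub_eq_zero, ← Module.forall_dual_apply_eq_zero_iff k]
          intro φ
          rw [map_sub, ← apply_coef, hc _ (hu.coef_mem_signPart hs hsV φ v), ← one_apply_eq,
            apply_coef, one_smul, map_smul, smul_eq_mul, sub_self]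
        rw [← hsV]
        refine congrArg (trace k V) (LinearMap.ext fun v => ?_)
        change (1 - u * c) • v = (1 - s • u) • v
        rw [sub_smul, sub_smul, mul_smul, hcv, smul_assoc]
        congr 1
        exact (Algebra.lsmul k k V u).map_smul s v
      rcases hu.exists_sign (V := V) hp with h | h
      · exact haux hp h hcp
      · exact haux hm h hcm
    rw [AddSubmonoid.mem_bot, traceOn_sub, traceOn_one, sub_eq_zero] at key
    exact key.symm

end Cotriangular

namespace Cotriangular

section Antipode

variable {ι : Type*} [Fintype ι] [DecidableEq ι] {T : Matrix ι ι A}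

theorem IsMult.antipode_mul (hT : IsMult k T) :
    T.map (HopfAlgebra.antipode k) * T = 1 := by
  ext i j
  have := HopfAlgebra.mul_antipode_rTensor_comul_apply (R := k) (T i j)
  simp only [hT.comul, hT.counit, map_sum, LinearMap.rTensor_tmul, mul'_apply] at this
  rw [Matrix.mul_apply]
  simp only [Matrix.map_apply, this, Matrix.one_apply]
  split_ifs <;> simp

theorem IsMult.mul_antipode (hT : IsMult k T) :
    T * T.map (HopfAlgebra.antipode k) = 1 := by
  ext i j
  have := HopfAlgebra.mul_antipode_lTensor_comul_apply (R := k) (T i j)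
  simp only [hT.comul, hT.counit, map_sum, LinearMap.lTensor_tmul, mul'_apply] at this
  rw [Matrix.mul_apply]
  simp only [Matrix.map_apply, this, Matrix.one_apply]
  split_ifs <;> simp

theorem IsMult.comul_antipode (hT : IsMult k T) (i j : ι) :
    Coalgebra.comul (R := k) (HopfAlgebra.antipode k (T i j)) =
      ∑ l, HopfAlgebra.antipode k (T l j) ⊗ₜ[k] HopfAlgebra.antipode k (T i l) := by
  let D : Matrix ι ι (A ⊗[k] A) := T.map (Bialgebra.comulAlgHom k A)
  let L : Matrix ι ι (A ⊗[k] A) :=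
    (T.map (HopfAlgebra.antipode k)).map (Bialgebra.comulAlgHom k A)
  let E : Matrix ι ι (A ⊗[k] A) := fun i j =>
    ∑ l, HopfAlgebra.antipode k (T l j) ⊗ₜ[k] HopfAlgebra.antipode k (T i l)
  have hLD : L * D = 1 := by
    rw [← Matrix.map_mul, hT.antipode_mul, Matrix.map_one _ (map_zero _) (map_one _)]
  have hDE : D * E = 1 := by
    ext i m
    have h1 (p q : ι) : ∑ j, T p j * HopfAlgebra.antipode k (T j q) = (1 : Matrix ι ι A) p q := by
      rw [← hT.mul_antipode, Matrix.mul_apply]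
      rfl
    have h2 : (D * E) i m = ∑ l, ∑ p, (T i l * HopfAlgebra.antipode k (T p m)) ⊗ₜ[k]
        ∑ j, T l j * HopfAlgebra.antipode k (T j p) := by
      rw [Matrix.mul_apply]
      simp only [D, E, Matrix.map_apply, Bialgebra.comulAlgHom_apply, hT.comul,
        Finset.sum_mul_sum, Algebra.TensorProduct.tmul_mul_tmul, TensorProduct.tmul_sum]
      rw [Finset.sum_comm]
      exact Finset.sum_congr rfl fun l _ => Finset.sum_comm
    rw [h2]
    simp only [h1, Matrix.one_apply, TensorProduct.tmul_ite,
      Finset.sum_ite_eq, Finset.mem_univ, if_true, ← TensorProduct.sum_tmul]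
    split_ifs <;> simp [Algebra.TensorProduct.one_def]
  have hLE : L = E := left_inv_eq_right_inv hLD hDE
  exact congrFun (congrFun hLE i) j

/-- The multiplicative matrix of the dual comodule. -/
theorem IsMult.dual (hT : IsMult k T) :
    IsMult k (T.map (HopfAlgebra.antipode k)).transpose where
  comul i j := hT.comul_antipode j i
  counit i j := by
    simp [hT.counit, Matrix.one_apply, eq_comm]

end Antipode

section Ext

variable {M : Type*} [AddCommMonoid M] [Module k M]

theorem eq_of_mult_eq {f g : A →ₗ[k] M}
    (h : ∀ (n : ℕ) (T : Matrix (Fin n) (Fin n) A), IsMult k T → ∀ i j, f (T i j) = g (T i j))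
    (a : A) : f a = g a :=
  mult_induction (k := k) (p := fun a => f a = g a) h (by simp)
    (fun a b ha hb => by simp [ha, hb]) (fun c a ha => by simp [ha]) a

theorem eq_of_mult_eq₂ {f g : A →ₗ[k] A →ₗ[k] M}
    (h : ∀ (n : ℕ) (T : Matrix (Fin n) (Fin n) A), IsMult k T →
      ∀ (m : ℕ) (T' : Matrix (Fin m) (Fin m) A), IsMult k T' →
      ∀ i j p q, f (T i j) (T' p q) = g (T i j) (T' p q))
    (a b : A) : f a b = g a b :=
  eq_of_mult_eq (k := k) (f := f.flip b) (g := g.flip b) (fun n T hT i j =>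
    eq_of_mult_eq (fun m T' hT' p q => h n T hT m T' hT' i j p q) b) a

end Ext

section Pairing

variable {ι κ : Type*} [Fintype ι] [DecidableEq ι] [Fintype κ] [DecidableEq κ]
  {T : Matrix ι ι A} {T' : Matrix κ κ A}

theorem conv2_apply_mult (hT : IsMult k T) (hT' : IsMult k T') (X Y : A ⊗[k] A →ₗ[k] k)
    (i j : ι) (p q : κ) : conv2 X Y (T i j ⊗ₜ T' p q) =
      ∑ l, ∑ r, X (T i l ⊗ₜ T' p r) * Y (T l j ⊗ₜ T' r q) := by
  simp [conv2, TensorProduct.comul_tmul, hT.comul, hT'.comul, TensorProduct.sum_tmul,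
    TensorProduct.tmul_sum]
  exact Finset.sum_comm

variable {R : A ⊗[k] A →ₗ[k] k}

theorem drinfeld_apply_mult (hT : IsMult k T) (i j : ι) :
    drinfeld R (T i j) = ∑ p, R (T p j ⊗ₜ HopfAlgebra.antipode k (T i p)) := by
  simp [drinfeld, hT.comul]

variable (hR : IsCT (mul' k A) R)
include hR

theorem tri_right_mult (hT : IsMult k T) (hT' : IsMult k T') (i j : ι) (p q : κ) :
    ∑ l, ∑ r, R (T i l ⊗ₜ T' p r) * R (T' r q ⊗ₜ T l j) =
      (1 : Matrix ι ι k) i j * (1 : Matrix κ κ k) p q := by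
  have := LinearMap.congr_fun hR.tri_right (T i j ⊗ₜ T' p q)
  rw [conv2_apply_mult hT hT'] at this
  simpa [eps2, hT.counit, hT'.counit, mul_comm] using this

theorem mul_left_mult (hT' : IsMult k T') (a b : A) (p q : κ) :
    R ((a * b) ⊗ₜ T' p q) = ∑ r, R (a ⊗ₜ T' p r) * R (b ⊗ₜ T' r q) := by
  have := LinearMap.congr_fun hR.mul_left ((a ⊗ₜ b) ⊗ₜ T' p q)
  simpa [hT'.comul, TensorProduct.tmul_sum] using this

theorem mul_right_mult (hT : IsMult k T) (b c : A) (i j : ι) :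
    R (T i j ⊗ₜ (b * c)) = ∑ l, R (T i l ⊗ₜ c) * R (T l j ⊗ₜ b) := by
  have := LinearMap.congr_fun hR.mul_right (T i j ⊗ₜ (b ⊗ₜ c))
  simpa [hT.comul, TensorProduct.sum_tmul] using this

theorem comm_rel_mult (hT : IsMult k T) (hT' : IsMult k T') (i j : ι) (p q : κ) :
    ∑ l, ∑ r, R (T l j ⊗ₜ T' r q) • (T' p r * T i l) =
      ∑ l, ∑ r, R (T i l ⊗ₜ T' p r) • (T l j * T' r q) := by
  have := LinearMap.congr_fun hR.comm_rel (T i j ⊗ₜ T' p q)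
  simp [TensorProduct.comul_tmul, hT.comul, hT'.comul, TensorProduct.sum_tmul,
    TensorProduct.tmul_sum] at this
  rw [Finset.sum_comm, this, Finset.sum_comm]

theorem antipode_left_mult (hT : IsMult k T) (hT' : IsMult k T') (i j : ι) (p q : κ) :
    R (HopfAlgebra.antipode k (T i j) ⊗ₜ T' p q) = R (T' p q ⊗ₜ T i j) := by
  let X : Matrix (ι × κ) (ι × κ) k := fun x y =>
    R (HopfAlgebra.antipode k (T x.1 y.1) ⊗ₜ T' x.2 y.2)
  let Y : Matrix (ι × κ) (ι × κ) k := fun x y => R (T x.1 y.1 ⊗ₜ T' x.2 y.2)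
  let Z : Matrix (ι × κ) (ι × κ) k := fun x y => R (T' x.2 y.2 ⊗ₜ T x.1 y.1)
  have hXY : X * Y = 1 := by
    ext ⟨i, p⟩ ⟨j, q⟩
    have h : ∑ l, HopfAlgebra.antipode k (T i l) * T l j = (1 : Matrix ι ι A) i j := by
      rw [← hT.antipode_mul, Matrix.mul_apply]
      rfl
    rw [Matrix.mul_apply]
    simp only [Fintype.sum_prod_type, X, Y, ← mul_left_mult hR hT', ← map_sum,
      ← TensorProduct.sum_tmul, h, Matrix.one_apply, Prod.mk.injEq]
    split_ifs <;> simp_all [hR.unit_left, hT'.counit, Matrix.one_apply]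
  have hYZ : Y * Z = 1 := by
    ext ⟨i, p⟩ ⟨j, q⟩
    rw [Matrix.mul_apply]
    simp only [Fintype.sum_prod_type, Y, Z, tri_right_mult hR hT hT',
      Matrix.one_apply, Prod.mk.injEq]
    split_ifs <;> simp_all
  have hXZ : X = Z := left_inv_eq_right_inv hXY hYZ
  exact congrFun (congrFun hXZ (i, p)) (j, q)

theorem antipode_left (a b : A) : R (HopfAlgebra.antipode k a ⊗ₜ b) = R (b ⊗ₜ a) :=
  eq_of_mult_eq₂ (f := (TensorProduct.mk k A A).compr₂ R ∘ₗ HopfAlgebra.antipode k)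
    (g := ((TensorProduct.mk k A A).compr₂ R).flip)
    (fun _ _ hT _ _ hT' i j p q => antipode_left_mult hR hT hT' i j p q) a b

theorem antipode_antipode (a b : A) :
    R (HopfAlgebra.antipode k a ⊗ₜ HopfAlgebra.antipode k b) = R (a ⊗ₜ b) := by
  rw [antipode_left hR, antipode_left hR]

theorem drinfeld_mul_eq (hT : IsMult k T) (i j : ι) :
    ∑ p, drinfeld R (T i p) • T p j =
      ∑ p, drinfeld R (T p j) • HopfAlgebra.antipode k (HopfAlgebra.antipode k (T i p)) := by
  have hS (p q : ι) : ∑ l, HopfAlgebra.antipode k (T p l) * T l q = (1 : Matrix ι ι A) p q := by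
    rw [← hT.antipode_mul, Matrix.mul_apply]
    rfl
  have h (m : ι) : drinfeld R (T m j) • (1 : A) =
      ∑ p, ∑ q, drinfeld R (T q p) • (T p j * HopfAlgebra.antipode k (T m q)) := by
    have key : ∑ i, ∑ l, ∑ r, R (T l j ⊗ₜ HopfAlgebra.antipode k (T m r)) •
          (HopfAlgebra.antipode k (T r i) * T i l) =
        ∑ i, ∑ l, ∑ r, R (T i l ⊗ₜ HopfAlgebra.antipode k (T r i)) •
          (T l j * HopfAlgebra.antipode k (T m r)) :=
      Finset.sum_congr rfl fun i _ => comm_rel_mult hR hT hT.dual i j i m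
    rw [Finset.sum_comm] at key
    conv_rhs at key => rw [Finset.sum_comm]
    have e1 (l : ι) : ∑ i, ∑ r, R (T l j ⊗ₜ HopfAlgebra.antipode k (T m r)) •
        (HopfAlgebra.antipode k (T r i) * T i l) =
        R (T l j ⊗ₜ HopfAlgebra.antipode k (T m l)) • (1 : A) := by
      rw [Finset.sum_comm]
      simp only [← Finset.smul_sum, hS, Matrix.one_apply, smul_ite, smul_zero,
        Finset.sum_ite_eq', Finset.mem_univ, if_true]
    have e2 (l : ι) : ∑ i, ∑ r, R (T i l ⊗ₜ HopfAlgebra.antipode k (T r i)) •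
        (T l j * HopfAlgebra.antipode k (T m r)) =
        ∑ r, drinfeld R (T r l) • (T l j * HopfAlgebra.antipode k (T m r)) := by
      rw [Finset.sum_comm]
      simp only [← Finset.sum_smul, drinfeld_apply_mult hT]
    simp only [e1, e2] at key
    rw [drinfeld_apply_mult hT, Finset.sum_smul, key]
  have hSS (q : ι) : ∑ m, HopfAlgebra.antipode k (T m q) *
      HopfAlgebra.antipode k (HopfAlgebra.antipode k (T i m)) = (1 : Matrix ι ι A) i q := by
    simp only [← HopfAlgebra.antipode_mul_antidistrib, ← map_sum, hS, Matrix.one_apply]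
    split_ifs <;> simp
  have e (m : ι) : drinfeld R (T m j) • HopfAlgebra.antipode k (HopfAlgebra.antipode k (T i m)) =
      ∑ p, ∑ q, drinfeld R (T q p) • (T p j * (HopfAlgebra.antipode k (T m q) *
        HopfAlgebra.antipode k (HopfAlgebra.antipode k (T i m)))) := by
    rw [← one_mul (HopfAlgebra.antipode k (HopfAlgebra.antipode k (T i m))), ← smul_mul_assoc, h]
    simp only [Finset.sum_mul, smul_mul_assoc, mul_assoc, one_mul]
  simp only [e]
  rw [Finset.sum_comm]
  refine Finset.sum_congr rfl fun p _ => ?_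
  rw [Finset.sum_comm]
  simp only [← Finset.smul_sum, ← Finset.mul_sum, hSS, Matrix.one_apply, mul_ite, mul_one,
    mul_zero, smul_ite, smul_zero, Finset.sum_ite_eq, Finset.mem_univ, if_true]

end Pairing

end Cotriangular

namespace Cotriangular

section Entries

variable {ι : Type*} [Fintype ι] [DecidableEq ι] {T : Matrix ι ι A}

theorem mul_apply_mult (hT : IsMult k T) (f g : ConvDual k A) (i j : ι) :
    (f * g).toForm (T i j) = ∑ l, f.toForm (T i l) * g.toForm (T l j) := by
  simp [mul_apply_eq, hT.comul]

theorem hitR_mult (hT : IsMult k T) (f : ConvDual k A) (i j : ι) :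
    hitR f (T i j) = ∑ l, f.toForm (T i l) • T l j := by
  simp [hitR, hT.comul]

theorem hitL_mult (hT : IsMult k T) (f : ConvDual k A) (i j : ι) :
    hitL f (T i j) = ∑ l, f.toForm (T l j) • T i l := by
  simp [hitL, hT.comul]

end Entries

/-- Rearrangement of a six-fold sum. -/
theorem sum_six {ι κ : Type*} [Fintype ι] [Fintype κ] (a : ι → ι → ι → k) (b : ι → κ → κ → k)
    (c : ι → κ → κ → k) (d : κ → κ → k) :
    ∑ p, ∑ q, ∑ x, ∑ y, (∑ r, a p r x * b r q y) * (∑ s, c x q s * d y s) =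
      ∑ s, ∑ y, (∑ r, ∑ q, (∑ x, (∑ p, a p r x) * c x q s) * b r q y) * d y s := by
  have hl : ∑ p, ∑ q, ∑ x, ∑ y, (∑ r, a p r x * b r q y) * (∑ s, c x q s * d y s) =
      ∑ z : ι × κ × ι × κ × ι × κ, a z.1 z.2.2.2.2.1 z.2.2.1 * b z.2.2.2.2.1 z.2.1 z.2.2.2.1 *
        (c z.2.2.1 z.2.1 z.2.2.2.2.2 * d z.2.2.2.1 z.2.2.2.2.2) := by
    simp only [Fintype.sum_prod_type, Finset.sum_mul_sum]
  have hr : ∑ s, ∑ y, (∑ r, ∑ q, (∑ x, (∑ p, a p r x) * c x q s) * b r q y) * d y s =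
      ∑ z : κ × κ × ι × κ × ι × ι, a z.2.2.2.2.2 z.2.2.1 z.2.2.2.2.1 *
        c z.2.2.2.2.1 z.2.2.2.1 z.1 * b z.2.2.1 z.2.2.2.1 z.2.1 * d z.2.1 z.1 := by
    simp only [Fintype.sum_prod_type, Finset.sum_mul]
  rw [hl, hr]
  refine Fintype.sum_equiv ⟨fun z => (z.2.2.2.2.2, z.2.2.2.1, z.2.2.2.2.1, z.2.1, z.2.2.1, z.1),
    fun z => (z.2.2.2.2.2, z.2.2.2.1, z.2.2.2.2.1, z.2.1, z.2.2.1, z.1),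
    fun _ => rfl, fun _ => rfl⟩ _ _ fun z => ?_
  simp only [Equiv.coe_fn_mk]
  ring

section Drinfeld

variable {R : A ⊗[k] A →ₗ[k] k} (hR : IsCT (mul' k A) R)
include hR

theorem drinfeld_one : drinfeld R 1 = 1 := by
  simp [drinfeld, Algebra.TensorProduct.one_def, hR.unit_left]

section Mult

variable {ι κ : Type*} [Fintype ι] [DecidableEq ι] [Fintype κ] [DecidableEq κ]
  {T : Matrix ι ι A} {T' : Matrix κ κ A}

theorem sum_drinfeld_mul (hT : IsMult k T) (i j : ι) (b : A) :
    ∑ x, drinfeld R (T i x) * R (T x j ⊗ₜ HopfAlgebra.antipode k b) =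
      ∑ x, drinfeld R (T x j) * R (HopfAlgebra.antipode k (T i x) ⊗ₜ b) := by
  have h := congrArg (fun a => R (a ⊗ₜ HopfAlgebra.antipode k b)) (drinfeld_mul_eq hR hT i j)
  simpa only [TensorProduct.sum_tmul, map_sum, ← TensorProduct.smul_tmul', LinearMap.map_smul,
    antipode_antipode hR, smul_eq_mul] using h

theorem drinfeld_mul_mult (hT : IsMult k T) (hT' : IsMult k T') (i j : ι) (m l : κ) :
    drinfeld R (T i j * T' m l) = drinfeld R (T i j) * drinfeld R (T' m l) := by
  have hK := hT.kronecker hT'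
  have h1 (p : ι) (q : κ) : R ((T p j * T' q l) ⊗ₜ HopfAlgebra.antipode k (T i p * T' m q)) =
      ∑ x, ∑ y, (∑ r, R (T p x ⊗ₜ HopfAlgebra.antipode k (T r p)) *
          R (T' q y ⊗ₜ HopfAlgebra.antipode k (T i r))) *
        ∑ s, R (T x j ⊗ₜ HopfAlgebra.antipode k (T' s q)) *
          R (T' y l ⊗ₜ HopfAlgebra.antipode k (T' m s)) := by
    rw [HopfAlgebra.antipode_mul_antidistrib]
    have := mul_right_mult hR hK (HopfAlgebra.antipode k (T' m q)) (HopfAlgebra.antipode k (T i p))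
      (p, q) (j, l)
    simp only [Matrix.kroneckerMap_apply, Fintype.sum_prod_type] at this
    rw [this]
    refine Finset.sum_congr rfl fun x _ => Finset.sum_congr rfl fun y _ => ?_
    congr 1
    · exact mul_left_mult hR hT.dual (T p x) (T' q y) p i
    · exact mul_left_mult hR hT'.dual (T x j) (T' y l) q m
  have h2 : drinfeld R (T i j * T' m l) = ∑ p, ∑ q,
      R ((T p j * T' q l) ⊗ₜ HopfAlgebra.antipode k (T i p * T' m q)) := by
    have := drinfeld_apply_mult (R := R) hK (i, m) (j, l)
    simpa only [Matrix.kroneckerMap_apply, Fintype.sum_prod_type] using this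
  have h3 (s y : κ) : ∑ r, ∑ q, (∑ x, drinfeld R (T r x) *
        R (T x j ⊗ₜ HopfAlgebra.antipode k (T' s q))) *
        R (T' q y ⊗ₜ HopfAlgebra.antipode k (T i r)) =
      if s = y then drinfeld R (T i j) else 0 := by
    have h4 (x : ι) := tri_right_mult hR hT.dual hT' x i s y
    simp only [Matrix.transpose_apply, Matrix.map_apply] at h4
    have h5 : ∑ r, ∑ q, (∑ x, drinfeld R (T r x) *
        R (T x j ⊗ₜ HopfAlgebra.antipode k (T' s q))) *
        R (T' q y ⊗ₜ HopfAlgebra.antipode k (T i r)) =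
        ∑ x, drinfeld R (T x j) * ∑ r, ∑ q, R (HopfAlgebra.antipode k (T r x) ⊗ₜ T' s q) *
          R (T' q y ⊗ₜ HopfAlgebra.antipode k (T i r)) := by
      simp only [sum_drinfeld_mul hR hT, Finset.sum_mul, Finset.mul_sum, mul_assoc]
      exact (Finset.sum_congr rfl fun r _ => Finset.sum_comm).trans Finset.sum_comm
    rw [h5]
    simp only [h4, Matrix.one_apply]
    split_ifs <;> simp
  rw [h2]
  simp only [h1]
  rw [sum_six (fun p r x => R (T p x ⊗ₜ HopfAlgebra.antipode k (T r p)))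
    (fun r q y => R (T' q y ⊗ₜ HopfAlgebra.antipode k (T i r)))
    (fun x q s => R (T x j ⊗ₜ HopfAlgebra.antipode k (T' s q)))
    (fun y s => R (T' y l ⊗ₜ HopfAlgebra.antipode k (T' m s)))]
  simp only [← drinfeld_apply_mult hT, h3, ite_mul, zero_mul, Finset.sum_ite_eq, Finset.mem_univ,
    if_true, ← Finset.mul_sum]
  rw [drinfeld_apply_mult hT']

end Mult

theorem drinfeld_mul (a b : A) : drinfeld R (a * b) = drinfeld R a * drinfeld R b :=
  eq_of_mult_eq₂ (f := (LinearMap.mul k A).compr₂ (drinfeld R))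
    (g := (LinearMap.mul k k).compl₁₂ (drinfeld R) (drinfeld R))
    (fun _ _ hT _ _ hT' i j p q => drinfeld_mul_mult hR hT hT' i j p q) a b

end Drinfeld

/-- A character of `A` composed with the antipode is its convolution inverse. -/
theorem mul_antipode_of_mul (f : A →ₗ[k] k) (h1 : f 1 = 1) (hmul : ∀ a b, f (a * b) = f a * f b) :
    ConvDual.ofForm f * ConvDual.ofForm (f ∘ₗ HopfAlgebra.antipode k) = 1 := by
  refine ConvDual.ext_form fun a => ?_
  refine eq_of_mult_eq (k := k) (f := (_ : ConvDual k A).toForm) (g := (1 : ConvDual k A).toForm)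
    (fun n T hT i j => ?_) a
  have h := congrArg f (congrFun (congrFun hT.mul_antipode i) j)
  rw [Matrix.mul_apply, map_sum] at h
  rw [mul_apply_mult hT, one_apply_eq, hT.counit]
  simp only [hmul, Matrix.map_apply] at h
  refine h.trans ?_
  simp only [Matrix.one_apply]
  split_ifs <;> simp [h1]

theorem antipode_mul_of_mul (f : A →ₗ[k] k) (h1 : f 1 = 1) (hmul : ∀ a b, f (a * b) = f a * f b) :
    ConvDual.ofForm (f ∘ₗ HopfAlgebra.antipode k) * ConvDual.ofForm f = 1 := by
  refine ConvDual.ext_form fun a => ?_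
  refine eq_of_mult_eq (k := k) (f := (_ : ConvDual k A).toForm) (g := (1 : ConvDual k A).toForm)
    (fun n T hT i j => ?_) a
  have h := congrArg f (congrFun (congrFun hT.antipode_mul i) j)
  rw [Matrix.mul_apply, map_sum] at h
  rw [mul_apply_mult hT, one_apply_eq, hT.counit]
  simp only [hmul, Matrix.map_apply] at h
  refine h.trans ?_
  simp only [Matrix.one_apply]
  split_ifs <;> simp [h1]

end Cotriangular

namespace Cotriangular

theorem IsBistable.comul_mem {F : Submodule k A} (hF : IsBistable F) {a : A} (ha : a ∈ F) :
    Coalgebra.comul a ∈ LinearMap.range (map F.subtype F.subtype) := by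
  obtain ⟨p, hp⟩ := F.subtype.exists_leftInverse_of_injective (by simp)
  have hp' (x : A) (hx : x ∈ F) : (p x : A) = x :=
    congrArg Subtype.val (LinearMap.congr_fun hp ⟨x, hx⟩)
  refine ⟨map p p (Coalgebra.comul a), eq_of_forall_pair fun f g => ?_⟩
  have h (φ ψ : A →ₗ[k] k) : mul' k k (map φ ψ (Coalgebra.comul a)) =
    (ConvDual.ofForm φ * ConvDual.ofForm ψ).toForm a := rfl
  have hmap (z : A ⊗[k] A) : map f g (map F.subtype F.subtype (map p p z)) =
      map (f ∘ₗ F.subtype ∘ₗ p) (g ∘ₗ F.subtype ∘ₗ p) z := by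
    rw [TensorProduct.map_comp, TensorProduct.map_comp]
    rfl
  rw [hmap, h, h, ← apply_smul]
  have h1 := hF.smul_mem (ConvDual.ofForm (g ∘ₗ F.subtype ∘ₗ p)) a ha
  have h2 := hF.hitR_mem (ConvDual.ofForm f) a ha
  calc (ConvDual.ofForm (f ∘ₗ F.subtype ∘ₗ p)).toForm
        (ConvDual.ofForm (g ∘ₗ F.subtype ∘ₗ p) • a)
      = f (ConvDual.ofForm (g ∘ₗ F.subtype ∘ₗ p) • a) := congrArg f (hp' _ h1)
    _ = (ConvDual.ofForm f * ConvDual.ofForm (g ∘ₗ F.subtype ∘ₗ p)).toForm a :=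
      apply_smul _ (ConvDual.ofForm f) a
    _ = (ConvDual.ofForm (g ∘ₗ F.subtype ∘ₗ p)).toForm (hitR (ConvDual.ofForm f) a) :=
      (apply_hitR _ _ a).symm
    _ = g (hitR (ConvDual.ofForm f) a) := congrArg g (hp' _ h2)
    _ = _ := apply_hitR _ (ConvDual.ofForm g) a

section Drinfeld

variable {R : A ⊗[k] A →ₗ[k] k} (hR : IsCT (mul' k A) R)
include hR

theorem twist_drinfeld : twist (ConvDual.ofForm (drinfeld R))
      (ConvDual.ofForm (drinfeld R ∘ₗ HopfAlgebra.antipode k)) =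
    HopfAlgebra.antipode k ∘ₗ HopfAlgebra.antipode k := by
  refine LinearMap.ext fun a => eq_of_mult_eq (k := k) (fun n T hT i j => ?_) a
  have hinv (p : Fin n) : ∑ m, drinfeld R (T p m) * drinfeld R (HopfAlgebra.antipode k (T m j)) =
      (1 : Matrix (Fin n) (Fin n) k) p j := by
    rw [← hT.counit, ← one_apply_eq,
      ← mul_antipode_of_mul (drinfeld R) (drinfeld_one hR) (drinfeld_mul hR), mul_apply_mult hT]
    rfl
  calc twist _ _ (T i j)
      = ∑ m, drinfeld R (HopfAlgebra.antipode k (T m j)) • ∑ l, drinfeld R (T i l) • T l m := by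
        simp only [twist, LinearMap.comp_apply, hitR_mult hT, map_sum, LinearMap.map_smul,
          hitL_mult hT, Finset.smul_sum, toForm_ofForm]
        rw [Finset.sum_comm]
        exact Finset.sum_congr rfl fun m _ => Finset.sum_congr rfl fun l _ => smul_comm _ _ _
    _ = ∑ p, (∑ m, drinfeld R (T p m) * drinfeld R (HopfAlgebra.antipode k (T m j))) •
          HopfAlgebra.antipode k (HopfAlgebra.antipode k (T i p)) := by
        simp only [drinfeld_mul_eq hR hT, Finset.smul_sum, Finset.sum_smul]
        rw [Finset.sum_comm]
        exact Finset.sum_congr rfl fun m _ => Finset.sum_congr rfl fun l _ => by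
          rw [smul_smul, mul_comm]
    _ = _ := by simp [hinv, Matrix.one_apply]

theorem trace_drinfeld_antipode {ι : Type*} [Fintype ι] [DecidableEq ι] {T : Matrix ι ι A}
    (hT : IsMult k T) :
    ∑ i, drinfeld R (HopfAlgebra.antipode k (T i i)) = ∑ i, drinfeld R (T i i) := by
  have h (i : ι) : drinfeld R (HopfAlgebra.antipode k (T i i)) =
      ∑ p, R (T i p ⊗ₜ HopfAlgebra.antipode k (T p i)) := by
    have := drinfeld_apply_mult (R := R) hT.dual i i
    simpa only [Matrix.transpose_apply, Matrix.map_apply, antipode_antipode hR] using this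
  simp only [h, drinfeld_apply_mult hT]
  exact Finset.sum_comm

theorem isPseudoUnit_drinfeld (hpi : Pseudoinvolutive k A) :
    IsPseudoUnit (ConvDual.ofForm (drinfeld R))
      (ConvDual.ofForm (drinfeld R ∘ₗ HopfAlgebra.antipode k)) where
  mul_inv := mul_antipode_of_mul _ (drinfeld_one hR) (drinfeld_mul hR)
  inv_mul := antipode_mul_of_mul _ (drinfeld_one hR) (drinfeld_mul hR)
  trace_twist F _ hF := by
    have key : ∀ (φ : A →ₗ[k] A) (h : ∀ x ∈ F, φ x ∈ F),
        φ = HopfAlgebra.antipode k ∘ₗ HopfAlgebra.antipode k →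
        trace k F (φ.restrict h) = (Module.finrank k F : k) := by
      rintro φ h rfl
      exact hpi F inferInstance (fun c hc => hF.comul_mem hc) h
    exact key _ _ (twist_drinfeld hR)
  trace_symm n T hT := trace_drinfeld_antipode hR hT

end Drinfeld

section Twisting

variable {R : A ⊗[k] A →ₗ[k] k}

theorem drinfeld_conv2_pairForm (f g : A →ₗ[k] k) :
    ConvDual.ofForm (drinfeld (conv2 R (pairForm f g))) =
      ConvDual.ofForm (g ∘ₗ HopfAlgebra.antipode k) * ConvDual.ofForm (drinfeld R) *
        ConvDual.ofForm f := by
  refine ConvDual.ext_form fun a => ?_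
  refine eq_of_mult_eq (k := k) (f := (_ : ConvDual k A).toForm) (g := (_ : ConvDual k A).toForm)
    (fun n T hT i j => ?_) a
  have h (p : Fin n) := conv2_apply_mult hT hT.dual R (pairForm f g) p j p i
  have hfg (x y : A) : pairForm f g (x ⊗ₜ y) = f x * g y := rfl
  simp only [Matrix.transpose_apply, Matrix.map_apply, hfg] at h
  simp only [toForm_ofForm, mul_apply_mult hT, drinfeld_apply_mult hT, h, LinearMap.comp_apply,
    Finset.sum_mul, Finset.mul_sum]
  rw [Finset.sum_comm]
  refine Finset.sum_congr rfl fun l _ => ?_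
  rw [Finset.sum_comm]
  refine Finset.sum_congr rfl fun r _ => Finset.sum_congr rfl fun p _ => ?_
  ring

theorem drinfeld_conv2_Rc [CharZero k] {c : A →ₗ[k] k} (h1 : c 1 = 1)
    (hmul : ∀ a b, c (a * b) = c a * c b)
    (hc : ∀ f, ConvDual.ofForm c * f = f * ConvDual.ofForm c)
    (hcc : ConvDual.ofForm c * ConvDual.ofForm c = 1) :
    drinfeld (conv2 R (Rc c)) = conv1 (drinfeld R) c := by
  have hS : ConvDual.ofForm (c ∘ₗ HopfAlgebra.antipode k) = ConvDual.ofForm c :=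
    left_inv_eq_right_inv (antipode_mul_of_mul c h1 hmul) hcc
  have hε : ConvDual.ofForm (Coalgebra.counit (R := k) (A := A)) = 1 := rfl
  have hεS : ConvDual.ofForm ((Coalgebra.counit (R := k) (A := A)) ∘ₗ HopfAlgebra.antipode k) = 1 :=
    ConvDual.ext_form fun a => by simp [one_apply_eq]
  have hlin : ConvDual.ofForm (drinfeld (conv2 R (Rc c))) = (2⁻¹ : k) •
      (ConvDual.ofForm (drinfeld (conv2 R (pairForm Coalgebra.counit Coalgebra.counit))) +
        ConvDual.ofForm (drinfeld (conv2 R (pairForm Coalgebra.counit c))) +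
        ConvDual.ofForm (drinfeld (conv2 R (pairForm c Coalgebra.counit))) -
        ConvDual.ofForm (drinfeld (conv2 R (pairForm c c)))) := by
    refine ConvDual.ext_form fun a => ?_
    refine eq_of_mult_eq (k := k) (f := (_ : ConvDual k A).toForm)
      (g := (_ : ConvDual k A).toForm) (fun n T hT i j => ?_) a
    have h (X : A ⊗[k] A →ₗ[k] k) (p : Fin n) := conv2_apply_mult hT hT.dual R X p j p i
    simp only [Matrix.transpose_apply, Matrix.map_apply] at h
    simp only [toForm_smul, toForm_sub, toForm_add, toForm_ofForm, LinearMap.smul_apply,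
      LinearMap.sub_apply, LinearMap.add_apply, drinfeld_apply_mult hT, h, Rc, smul_eq_mul,
      ← Finset.sum_add_distrib, ← Finset.sum_sub_distrib, Finset.mul_sum]
    refine Finset.sum_congr rfl fun p _ => Finset.sum_congr rfl fun l _ =>
      Finset.sum_congr rfl fun r _ => ?_
    ring
  have h2 : ConvDual.ofForm (drinfeld (conv2 R (Rc c))) =
      ConvDual.ofForm (drinfeld R) * ConvDual.ofForm c := by
    rw [hlin]
    simp only [drinfeld_conv2_pairForm, hε, hεS, hS, hc, one_mul, mul_one]
    rw [mul_assoc, hcc, mul_one, inv_smul_eq_iff₀ two_ne_zero, two_smul]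
    abel
  exact congrArg ConvDual.toForm h2

end Twisting

section Comodule

variable {V : Type u} [AddCommGroup V] [Module k V] {ι : Type*} [Fintype ι] [DecidableEq ι]
  (ρ : V →ₗ[k] V ⊗[k] A) (b : Module.Basis ι k V)

/-- The matrix of a comodule with respect to a basis. -/
def comodMat : Matrix ι ι A :=
  fun i j => TensorProduct.lid k A (map (b.coord i) LinearMap.id (ρ (b j)))

omit [DecidableEq ι] in
theorem sum_tmul_comodMat (j : ι) : ρ (b j) = ∑ l, b l ⊗ₜ comodMat ρ b l j := by
  have h (z : V ⊗[k] A) : z = ∑ l, b l ⊗ₜ TensorProduct.lid k A (map (b.coord l) LinearMap.id z) := by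
    induction z with
    | zero => simp
    | tmul v a =>
      simp only [TensorProduct.map_tmul, TensorProduct.lid_tmul, ← TensorProduct.smul_tmul,
        ← TensorProduct.sum_tmul]
      congr 1
      exact (b.sum_repr v).symm
    | add x y hx hy =>
      conv_lhs => rw [hx, hy]
      simp only [map_add, TensorProduct.tmul_add, Finset.sum_add_distrib]
  exact h _

theorem isMult_comodMat (hρ : IsComod V ρ) : IsMult k (comodMat ρ b) where
  comul i j := by
    have h := congrArg (TensorProduct.lid k (A ⊗[k] A) ∘ map (b.coord i) LinearMap.id)
      (LinearMap.congr_fun hρ.coassoc (b j))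
    simp only [LinearMap.comp_apply, sum_tmul_comodMat ρ b, map_sum, TensorProduct.map_tmul,
      TensorProduct.sum_tmul, LinearEquiv.coe_coe, TensorProduct.assoc_tmul, Function.comp_apply,
      TensorProduct.lid_tmul, LinearMap.id_apply, Module.Basis.coord_apply,
      Module.Basis.repr_self, Finsupp.single_apply] at h
    simpa using h.symm
  counit i j := by
    have h := congrArg (b.coord i) (LinearMap.congr_fun hρ.counit_id (b j))
    simp only [LinearMap.comp_apply, sum_tmul_comodMat ρ b, map_sum, TensorProduct.map_tmul,
      LinearEquiv.coe_coe, TensorProduct.rid_tmul, LinearMap.id_apply, Module.Basis.coord_apply,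
      Module.Basis.repr_self, LinearMap.map_smul, Finsupp.single_apply] at h
    simpa [Matrix.one_apply, Finsupp.single_apply, eq_comm] using h

theorem trace_coact (f : A →ₗ[k] k) :
    trace k V (coact ρ f) = (evalMat (ConvDual.ofForm f) (comodMat ρ b)).trace := by
  rw [LinearMap.trace_eq_matrix_trace k b]
  refine Finset.sum_congr rfl fun i _ => ?_
  simp [LinearMap.toMatrix_apply, coact, sum_tmul_comodMat ρ b, Finsupp.single_apply]

end Comodule

end Cotriangular

section

/-- For a pseudoinvolutive cotriangular Hopf algebra `(A, R)` over an
algebraically closed field `k` of characteristic `0`, with Drinfeld element `u`, there is a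
central grouplike `c ∈ A*` with `c ∗ c = ε` such that `u' = u ∗ c` is the Drinfeld element of
`(A, R ∗ R_c)` and `tr(u'|_V) = dim V` for every finite-dimensional right `A`-comodule `V`. -/
theorem statement0 {k A : Type u} [Field k] [IsAlgClosed k] [CharZero k]
    [Ring A] [HopfAlgebra k A]
    (R : A ⊗[k] A →ₗ[k] k) (hR : IsCT (mul' k A) R)
    (hpi : Pseudoinvolutive k A) :
    ∃ c : A →ₗ[k] k, IsGrouplikeForm c ∧ IsConvCentral c ∧
      conv1 c c = Coalgebra.counit ∧
      conv1 (drinfeld R) c = drinfeld (conv2 R (Rc c)) ∧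
      ∀ (V : Type u) [AddCommGroup V] [Module k V] [FiniteDimensional k V]
        (ρ : V →ₗ[k] V ⊗[k] A), IsComod V ρ →
          trace k V (coact ρ (conv1 (drinfeld R) c)) = (Module.finrank k V : k) := by
  have h1 := Cotriangular.drinfeld_one hR
  have hmul := Cotriangular.drinfeld_mul hR
  obtain ⟨c, hc1, hcmul, hcent, hcc, htr⟩ :=
    (Cotriangular.isPseudoUnit_drinfeld hR hpi).exists_central h1 hmul
  refine ⟨c.toForm, ⟨hc1, hcmul⟩,
    fun f => congrArg Cotriangular.ConvDual.toForm (hcent (Cotriangular.ConvDual.ofForm f)),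
    congrArg Cotriangular.ConvDual.toForm hcc,
    (Cotriangular.drinfeld_conv2_Rc hc1 hcmul hcent hcc).symm, fun V _ _ _ ρ hρ => ?_⟩
  have hT := Cotriangular.isMult_comodMat ρ (Module.finBasis k V) hρ
  rw [Cotriangular.trace_coact ρ (Module.finBasis k V)]
  have h := htr hT.Rep
  rwa [hT.traceOn_rep, hT.finrank_rep, Fintype.card_fin] at h

end

end
end

section
/- Let (A,R) be a pseudoinvolutive cotriangular Hopf algebra over k with Drinfeld element u, and let X be a simple finite-dimensional right A-comodule (X ≠ 0 and X has no nonzero proper subcomodule). Then either tr(u|_X) = dim X or tr(u|_X) = −dim X. -/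
open TensorProduct LinearMap

noncomputable section

universe u
variable {k A : Type u} [Field k] [Ring A] [HopfAlgebra k A]

/-- A multiplicative matrix over a Hopf algebra: `Δ(c i j) = Σ c i p ⊗ c p j` and
`ε(c i j) = δ i j`. -/
structure IsMultiplicative {n : Type*} [Fintype n] [DecidableEq n] (k : Type u) {A : Type u}
    [Field k] [Ring A] [HopfAlgebra k A] (c : Matrix n n A) : Prop where
  comul_apply : ∀ i j, Coalgebra.comul (R := k) (c i j) = ∑ p, c i p ⊗ₜ[k] c p j
  counit_apply : ∀ i j, Coalgebra.counit (R := k) (c i j) = (1 : Matrix n n k) i j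

namespace IsMultiplicative

open HopfAlgebra (antipode)

variable {n m : Type*} [Fintype n] [DecidableEq n] [Fintype m] [DecidableEq m]
  {c : Matrix n n A} {d : Matrix m m A}

lemma antipode_mul (hc : IsMultiplicative k c) : c.map (antipode k) * c = 1 := by
  ext i j
  have h := HopfAlgebra.mul_antipode_rTensor_comul_apply (R := k) (c i j)
  rw [hc.comul_apply, hc.counit_apply, map_sum, map_sum] at h
  simpa [Matrix.mul_apply, Matrix.one_apply, apply_ite (algebraMap k A)] using h

lemma mul_antipode (hc : IsMultiplicative k c) : c * c.map (antipode k) = 1 := by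
  ext i j
  have h := HopfAlgebra.mul_antipode_lTensor_comul_apply (R := k) (c i j)
  rw [hc.comul_apply, hc.counit_apply, map_sum, map_sum] at h
  simpa [Matrix.mul_apply, Matrix.one_apply, apply_ite (algebraMap k A)] using h

lemma comul_antipode (hc : IsMultiplicative k c) (i j : n) :
    Coalgebra.comul (R := k) (antipode k (c i j)) =
      ∑ p, antipode k (c p j) ⊗ₜ[k] antipode k (c i p) := by
  let s : Matrix n n A := c.map (antipode k)
  let l : A →+* A ⊗[k] A := (Algebra.TensorProduct.includeLeft : A →ₐ[k] A ⊗[k] A)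
  let r : A →+* A ⊗[k] A := (Algebra.TensorProduct.includeRight : A →ₐ[k] A ⊗[k] A)
  let Δ : A →+* A ⊗[k] A := (Bialgebra.comulAlgHom k A : A →ₐ[k] A ⊗[k] A)
  have hcs : c * s = 1 := hc.mul_antipode
  have hsc : s * c = 1 := hc.antipode_mul
  have key (f : A →+* A ⊗[k] A) : f.mapMatrix c * f.mapMatrix s = 1 ∧
      f.mapMatrix s * f.mapMatrix c = 1 := by
    rw [← map_mul, ← map_mul, hcs, hsc, map_one]
    exact ⟨rfl, rfl⟩
  have hΔ : Δ.mapMatrix c = l.mapMatrix c * r.mapMatrix c := by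
    ext i j
    simp [Matrix.mul_apply, Δ, l, r, hc.comul_apply]
  have h : Δ.mapMatrix s = r.mapMatrix s * l.mapMatrix s := by
    refine left_inv_eq_right_inv (key Δ).2 ?_
    rw [hΔ, mul_assoc, ← mul_assoc (r.mapMatrix c), (key r).1, one_mul, (key l).1]
  simpa [Matrix.mul_apply, Δ, l, r, s] using congr_fun₂ h i j

lemma antipode_transpose (hc : IsMultiplicative k c) :
    IsMultiplicative k (c.map (antipode k)).transpose where
  comul_apply i j := by simp [hc.comul_antipode]
  counit_apply i j := by simp [hc.counit_apply, Matrix.one_apply, eq_comm]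

lemma conv2_apply (hc : IsMultiplicative k c) (hd : IsMultiplicative k d)
    (f g : A ⊗[k] A →ₗ[k] k) (i j : n) (a b : m) :
    conv2 f g (c i j ⊗ₜ d a b) = ∑ p, ∑ q, f (c i p ⊗ₜ d a q) * g (c p j ⊗ₜ d q b) := by
  simp only [conv2, LinearMap.comp_apply, TensorProduct.comul_tmul, hc.comul_apply, hd.comul_apply,
    TensorProduct.sum_tmul, TensorProduct.tmul_sum]
  simpa using Finset.sum_comm

lemma mul_left_apply (hd : IsMultiplicative k d) {R : A ⊗[k] A →ₗ[k] k}
    (hR : IsCQT (mul' k A) R) (x y : A) (a b : m) :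
    R ((x * y) ⊗ₜ d a b) = ∑ q, R (x ⊗ₜ d a q) * R (y ⊗ₜ d q b) := by
  have h := LinearMap.congr_fun hR.mul_left ((x ⊗ₜ y) ⊗ₜ d a b)
  simpa [hd.comul_apply, TensorProduct.tmul_sum] using h

lemma mul_right_apply (hc : IsMultiplicative k c) {R : A ⊗[k] A →ₗ[k] k}
    (hR : IsCQT (mul' k A) R) (x y : A) (i j : n) :
    R (c i j ⊗ₜ (x * y)) = ∑ p, R (c i p ⊗ₜ y) * R (c p j ⊗ₜ x) := by
  have h := LinearMap.congr_fun hR.mul_right (c i j ⊗ₜ (x ⊗ₜ y))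
  simpa [hc.comul_apply, TensorProduct.sum_tmul] using h

lemma comm_apply (hc : IsMultiplicative k c) (hd : IsMultiplicative k d) {R : A ⊗[k] A →ₗ[k] k}
    (hR : IsCQT (mul' k A) R) (i j : n) (a b : m) :
    ∑ p, ∑ q, R (c p j ⊗ₜ d q b) • (d a q * c i p) =
      ∑ p, ∑ q, R (c i p ⊗ₜ d a q) • (c p j * d q b) := by
  have h := LinearMap.congr_fun hR.comm_rel (c i j ⊗ₜ d a b)
  rw [Finset.sum_comm, Finset.sum_comm (f := fun p q ↦ R (c i p ⊗ₜ d a q) • (c p j * d q b))]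
  simpa [hc.comul_apply, hd.comul_apply, TensorProduct.sum_tmul, TensorProduct.tmul_sum] using h

lemma antipode_tmul (hc : IsMultiplicative k c) (hd : IsMultiplicative k d)
    {R : A ⊗[k] A →ₗ[k] k} (hR : IsCT (mul' k A) R) (i j : n) (a b : m) :
    R (antipode k (c i j) ⊗ₜ d a b) = R (d a b ⊗ₜ c i j) := by
  let M : Matrix (n × m) (n × m) k := .of fun x y ↦ R (c x.1 y.1 ⊗ₜ d x.2 y.2)
  let N : Matrix (n × m) (n × m) k := .of fun x y ↦ R (d x.2 y.2 ⊗ₜ c x.1 y.1)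
  let L : Matrix (n × m) (n × m) k := .of fun x y ↦ R (antipode k (c x.1 y.1) ⊗ₜ d x.2 y.2)
  have hMN : M * N = 1 := by
    ext ⟨i, a⟩ ⟨j, b⟩
    have h := LinearMap.congr_fun hR.tri_right (c i j ⊗ₜ d a b)
    rw [hc.conv2_apply hd] at h
    simpa [Matrix.mul_apply, M, N, Fintype.sum_prod_type, eps2, hc.counit_apply, hd.counit_apply,
      Matrix.one_apply, Prod.ext_iff, ← ite_and, and_comm (a := a = b)] using h
  have hLM : L * M = 1 := by
    ext ⟨i, a⟩ ⟨j, b⟩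
    have h : ∑ p, R ((antipode k (c i p) * c p j) ⊗ₜ d a b) =
        (1 : Matrix n n k) i j * (1 : Matrix m m k) a b := by
      rw [← map_sum, ← TensorProduct.sum_tmul]
      have h1 := congr_fun₂ hc.antipode_mul i j
      simp only [Matrix.mul_apply, Matrix.map_apply] at h1
      simp only [h1, Matrix.one_apply]
      split_ifs <;> simp [hR.unit_left, hd.counit_apply, *]
    simpa [Matrix.mul_apply, M, L, Fintype.sum_prod_type, hd.mul_left_apply hR.toIsCQT,
      Matrix.one_apply, Prod.ext_iff, ← ite_and, and_comm (a := a = b)] using h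
  have hLN : L = N := left_inv_eq_right_inv hLM hMN
  exact congr_fun (congr_fun hLN (i, a)) (j, b)

lemma drinfeld_apply (hc : IsMultiplicative k c) (R : A ⊗[k] A →ₗ[k] k) (i j : n) :
    drinfeld R (c i j) = ∑ p, R (c p j ⊗ₜ antipode k (c i p)) := by
  simp [drinfeld, hc.comul_apply]

/-- The Drinfeld element intertwines the identity and the square of the antipode. -/
lemma antipode_sq_mul_drinfeld (hc : IsMultiplicative k c) {R : A ⊗[k] A →ₗ[k] k}
    (hR : IsCQT (mul' k A) R) (i j : n) :
    ∑ p, drinfeld R (c p j) • antipode k (antipode k (c i p)) =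
      ∑ p, drinfeld R (c i p) • c p j := by
  have hs := hc.antipode_transpose
  have h1 (l j : n) : ∑ q, ∑ p, drinfeld R (c q p) • (c p j * antipode k (c l q)) =
      algebraMap k A (drinfeld R (c l j)) := by
    have h := Finset.sum_congr (rfl : (Finset.univ : Finset n) = Finset.univ)
      fun i _ ↦ hc.comm_apply hs hR i j i l
    simp only [Matrix.transpose_apply, Matrix.map_apply] at h
    have hL : ∑ i, ∑ p, ∑ q, R (c p j ⊗ₜ antipode k (c l q)) • (antipode k (c q i) * c i p) =
        algebraMap k A (drinfeld R (c l j)) := by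
      rw [Finset.sum_comm, hc.drinfeld_apply, map_sum]
      refine Finset.sum_congr rfl fun p _ ↦ ?_
      rw [Finset.sum_comm]
      simp_rw [← Finset.smul_sum]
      have h2 (q : n) : ∑ i, antipode k (c q i) * c i p = (1 : Matrix n n A) q p :=
        congr_fun₂ hc.antipode_mul q p
      simp [h2, Matrix.one_apply, Algebra.algebraMap_eq_smul_one]
    rw [← hL, h]
    simp_rw [hc.drinfeld_apply, Finset.sum_smul]
    rw [Finset.sum_comm_cycle]
    exact Finset.sum_congr rfl fun i _ ↦ Finset.sum_comm
  have h3 (q : n) : ∑ p, antipode k (c p q) * antipode k (antipode k (c i p)) =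
      (1 : Matrix n n A) q i :=
    congr_fun₂ hs.mul_antipode q i
  calc ∑ p, drinfeld R (c p j) • antipode k (antipode k (c i p))
      = ∑ p, ∑ q, ∑ r, drinfeld R (c q r) •
          (c r j * (antipode k (c p q) * antipode k (antipode k (c i p)))) := by
        refine Finset.sum_congr rfl fun p _ ↦ ?_
        rw [Algebra.smul_def, ← h1]
        simp [Finset.sum_mul, mul_assoc]
    _ = ∑ q, ∑ r, drinfeld R (c q r) •
          (c r j * ∑ p, antipode k (c p q) * antipode k (antipode k (c i p))) := by
        rw [← Finset.sum_comm_cycle]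
        simp [Finset.mul_sum, Finset.smul_sum]
    _ = ∑ p, drinfeld R (c i p) • c p j := by
        simp_rw [h3]
        rw [Finset.sum_comm]
        simp [Matrix.one_apply]

lemma inverse_drinfeld_mul (hc : IsMultiplicative k c) {R : A ⊗[k] A →ₗ[k] k}
    (hR : IsCT (mul' k A) R) :
    (.of fun i j ↦ ∑ p, R (c i p ⊗ₜ antipode k (c p j)) : Matrix n n k) *
      c.map (drinfeld R) = 1 := by
  ext i j
  have hs := hc.antipode_transpose
  have h1 (p q : n) : R (c i p ⊗ₜ antipode k (c p q)) =
      R (antipode k (antipode k (c p q)) ⊗ₜ c i p) :=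
    (hs.antipode_tmul hc hR q p i p).symm
  have h2 (r : n) : ∑ p, c i p * antipode k (c p r) = (1 : Matrix n n A) i r :=
    congr_fun₂ hc.mul_antipode i r
  calc ∑ q, (∑ p, R (c i p ⊗ₜ antipode k (c p q))) * drinfeld R (c q j)
      = ∑ p, R ((∑ q, drinfeld R (c q j) • antipode k (antipode k (c p q))) ⊗ₜ c i p) := by
        simp_rw [h1, Finset.sum_mul]
        rw [Finset.sum_comm]
        simp [TensorProduct.sum_tmul, ← TensorProduct.smul_tmul', mul_comm]
    _ = ∑ p, ∑ q, ∑ r, R (c r q ⊗ₜ antipode k (c p r)) * R (c q j ⊗ₜ c i p) := by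
        simp_rw [hc.antipode_sq_mul_drinfeld hR.toIsCQT, hc.drinfeld_apply]
        simp [TensorProduct.sum_tmul, ← TensorProduct.smul_tmul', Finset.sum_mul]
    _ = ∑ p, ∑ r, R (c r j ⊗ₜ (c i p * antipode k (c p r))) := by
        simp_rw [hc.mul_right_apply hR.toIsCQT]
        exact Finset.sum_congr rfl fun p _ ↦ Finset.sum_comm
    _ = ∑ r, R (c r j ⊗ₜ ∑ p, c i p * antipode k (c p r)) := by
        rw [Finset.sum_comm]
        simp [TensorProduct.tmul_sum]
    _ = (1 : Matrix n n k) i j := by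
        simp_rw [h2, Matrix.one_apply]
        simp [hR.unit_right, apply_ite, hc.counit_apply, Matrix.one_apply]

end IsMultiplicative

section Comodule

variable {X : Type u} [AddCommGroup X] [Module k X] {n : Type*} [Fintype n] [DecidableEq n]
  {ρ : X →ₗ[k] X ⊗[k] A}

/-- The matrix `c` of coefficients of `ρ` in a basis `b`: `ρ (b j) = Σ b i ⊗ c i j`. -/
def coeffMatrix (b : Module.Basis n k X) (ρ : X →ₗ[k] X ⊗[k] A) : Matrix n n A :=
  .of fun i j ↦ TensorProduct.equivFinsuppOfBasisLeft b (ρ (b j)) i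

lemma sum_tmul_coeffMatrix (b : Module.Basis n k X) (ρ : X →ₗ[k] X ⊗[k] A) (j : n) :
    ρ (b j) = ∑ i, b i ⊗ₜ coeffMatrix b ρ i j := by
  have h := TensorProduct.equivFinsuppOfBasisLeft_symm_apply b
    (TensorProduct.equivFinsuppOfBasisLeft b (ρ (b j)))
  rw [LinearEquiv.symm_apply_apply, Finsupp.sum_fintype _ _ (by simp)] at h
  exact h

lemma coact_basis (b : Module.Basis n k X) (ρ : X →ₗ[k] X ⊗[k] A) (f : A →ₗ[k] k) (j : n) :
    coact ρ f (b j) = ∑ i, f (coeffMatrix b ρ i j) • b i := by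
  simp [coact, sum_tmul_coeffMatrix]

lemma toMatrix_coact (b : Module.Basis n k X) (ρ : X →ₗ[k] X ⊗[k] A) (f : A →ₗ[k] k) :
    LinearMap.toMatrix b b (coact ρ f) = (coeffMatrix b ρ).map f := by
  ext i j
  simp [LinearMap.toMatrix_apply, coact_basis, Finsupp.single_apply]

lemma IsComod.isMultiplicative (hρ : IsComod X ρ) (b : Module.Basis n k X) :
    IsMultiplicative k (coeffMatrix b ρ) where
  comul_apply i j := by
    have h := LinearMap.congr_fun hρ.coassoc (b j)
    simp only [LinearMap.comp_apply, sum_tmul_coeffMatrix, map_sum, map_tmul,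
      TensorProduct.sum_tmul, LinearEquiv.coe_coe, TensorProduct.assoc_tmul, LinearMap.id_apply] at h
    have h := congr(TensorProduct.equivFinsuppOfBasisLeft b $h i)
    simpa [Finsupp.single_apply] using h.symm
  counit_apply i j := by
    have h := LinearMap.congr_fun hρ.counit_id (b j)
    simp only [LinearMap.comp_apply, sum_tmul_coeffMatrix, map_sum, map_tmul,
      LinearEquiv.coe_coe, LinearMap.id_apply, TensorProduct.rid_tmul] at h
    have h := congr(b.repr $h i)
    simpa [Finsupp.single_apply, Matrix.one_apply, eq_comm] using h

lemma isSubcomod_of_coact_mem {W : Submodule k X} (h : ∀ f : A →ₗ[k] k, ∀ w ∈ W, coact ρ f w ∈ W) :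
    IsSubcomod ρ W := by
  classical
  intro w hw
  let a := Module.Basis.ofVectorSpace k A
  have hs := TensorProduct.equivFinsuppOfBasisRight_symm_apply a
    (TensorProduct.equivFinsuppOfBasisRight a (ρ w))
  rw [LinearEquiv.symm_apply_apply] at hs
  rw [hs]
  refine Submodule.sum_mem _ fun i _ ↦ ?_
  have hi : TensorProduct.equivFinsuppOfBasisRight a (ρ w) i ∈ W := by
    rw [TensorProduct.equivFinsuppOfBasisRight_apply]
    exact h (a.coord i) w hw
  exact ⟨⟨_, hi⟩ ⊗ₜ a i, by simp⟩

/-- The algebra of all endomorphisms of a comodule that come from linear forms on `A`. -/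
def coactAlgebra (hρ : IsComod X ρ) (b : Module.Basis n k X) :
    Subalgebra k (Module.End k X) where
  carrier := Set.range (coact ρ)
  mul_mem' := by
    rintro _ _ ⟨f, rfl⟩ ⟨g, rfl⟩
    refine ⟨conv1 f g, (LinearMap.toMatrix b b).injective ?_⟩
    ext i j
    simp [LinearMap.toMatrix_mul, toMatrix_coact, Matrix.mul_apply, conv1,
      (hρ.isMultiplicative b).comul_apply]
  add_mem' := by
    rintro _ _ ⟨f, rfl⟩ ⟨g, rfl⟩
    refine ⟨f + g, (LinearMap.toMatrix b b).injective ?_⟩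
    ext i j
    simp [toMatrix_coact]
  algebraMap_mem' r := by
    refine ⟨r • Coalgebra.counit, (LinearMap.toMatrix b b).injective ?_⟩
    ext i j
    simp [toMatrix_coact, (hρ.isMultiplicative b).counit_apply, Algebra.algebraMap_eq_smul_one]

/-- Burnside's theorem for irreducible algebras of endomorphisms. -/
lemma Subalgebra.eq_top_of_irreducible [IsAlgClosed k] [FiniteDimensional k X] [Nontrivial X]
    (B : Subalgebra k (Module.End k X))
    (hB : ∀ W : Submodule k X, (∀ f ∈ B, ∀ w ∈ W, f w ∈ W) → W = ⊥ ∨ W = ⊤) : B = ⊤ := by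
  have : IsSimpleModule B X := by
    rw [isSimpleModule_iff]
    refine { eq_bot_or_eq_top := fun W ↦ ?_ }
    refine (hB (W.restrictScalars k) fun f hf w hw ↦ W.smul_mem (⟨f, hf⟩ : B) hw).imp ?_ ?_ <;>
    · intro h
      ext x
      simpa using SetLike.ext_iff.1 h x
  rw [eq_top_iff]
  intro T _
  let T' : Module.End (Module.End B X) X :=
    { toFun := T
      map_add' := map_add T
      map_smul' := fun φ x ↦ by
        obtain ⟨r, rfl⟩ := (IsSimpleModule.algebraMap_end_bijective_of_isAlgClosed k).2 φ
        simp }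
  classical
  let b := Module.finBasis k X
  obtain ⟨r, hr⟩ := jacobson_density (R := B) T' (Finset.univ.image b)
  have : T = r := b.ext fun i ↦ hr (b i) (by simp)
  exact this ▸ r.2

lemma linearIndependent_coeffMatrix [IsAlgClosed k] [FiniteDimensional k X] [Nontrivial X]
    (hρ : IsComod X ρ) (hsimple : ∀ W : Submodule k X, IsSubcomod ρ W → W = ⊥ ∨ W = ⊤)
    (b : Module.Basis n k X) :
    LinearIndependent k fun x : n × n ↦ coeffMatrix b ρ x.1 x.2 := by
  have htop : coactAlgebra hρ b = ⊤ := Subalgebra.eq_top_of_irreducible _ fun W hW ↦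
    hsimple W (isSubcomod_of_coact_mem fun f ↦ hW _ ⟨f, rfl⟩)
  rw [Fintype.linearIndependent_iff]
  rintro g hg ⟨i, j⟩
  obtain ⟨f, hf⟩ : Matrix.toLin b b (Matrix.single i j 1) ∈ coactAlgebra hρ b :=
    htop ▸ Algebra.mem_top
  have hf' : (coeffMatrix b ρ).map f = Matrix.single i j 1 := by
    rw [← toMatrix_coact, hf, LinearMap.toMatrix_toLin]
  have hf'' (p q : n) : f (coeffMatrix b ρ p q) = Matrix.single i j 1 p q := congr_fun₂ hf' p q
  simpa [hf'', Matrix.single_apply, Fintype.sum_prod_type, ite_and] using congr(f $hg)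

end Comodule

lemma IsMultiplicative.trace_drinfeld_sq {n : Type*} [Fintype n] [DecidableEq n]
    {c : Matrix n n A} (hc : IsMultiplicative k c) {R : A ⊗[k] A →ₗ[k] k}
    (hR : IsCT (mul' k A) R) (hpi : Pseudoinvolutive k A)
    (hli : LinearIndependent k fun x : n × n ↦ c x.1 x.2) :
    (c.map (drinfeld R)).trace ^ 2 = (Fintype.card n : k) ^ 2 := by
  set U := c.map (drinfeld R) with hU
  let V : Matrix n n k := .of fun i j ↦ ∑ p, R (c i p ⊗ₜ HopfAlgebra.antipode k (c p j))
  have hUV : U * V = 1 := mul_eq_one_comm.1 (hc.inverse_drinfeld_mul hR)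
  have htr : V.trace = U.trace := by
    simp only [Matrix.trace, Matrix.diag_apply, V, U, Matrix.map_apply, hc.drinfeld_apply,
      Matrix.of_apply]
    exact Finset.sum_comm
  let S2 : A →ₗ[k] A := HopfAlgebra.antipode k ∘ₗ HopfAlgebra.antipode k
  have hS2 (i j : n) : S2 (c i j) = ∑ p, ∑ q, (U i p * V q j) • c p q := by
    have hUV' (r : n) : ∑ q, U r q * V q j = (1 : Matrix n n k) r j := congr_fun₂ hUV r j
    calc S2 (c i j) = ∑ r, (∑ q, U r q * V q j) • S2 (c i r) := by
          simp [hUV', Matrix.one_apply]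
      _ = ∑ q, V q j • ∑ r, U r q • S2 (c i r) := by
          simp_rw [Finset.sum_smul, Finset.smul_sum, smul_smul, mul_comm]
          exact Finset.sum_comm
      _ = ∑ p, ∑ q, (U i p * V q j) • c p q := by
          simp_rw [S2, U, Matrix.map_apply, LinearMap.comp_apply,
            hc.antipode_sq_mul_drinfeld hR.toIsCQT, Finset.smul_sum, smul_smul]
          rw [Finset.sum_comm]
          simp_rw [mul_comm]
  let C := Submodule.span k (Set.range fun x : n × n ↦ c x.1 x.2)
  have hmem (i j : n) : c i j ∈ C := Submodule.subset_span ⟨(i, j), rfl⟩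
  let e : Module.Basis (n × n) k C := Module.Basis.span hli
  have he (x : n × n) : (e x : A) = c x.1 x.2 :=
    congr_arg Subtype.val (Module.Basis.span_apply hli x)
  have hstable : ∀ x ∈ C, S2 x ∈ C := by
    change C ≤ C.comap S2
    refine Submodule.span_le.2 ?_
    rintro _ ⟨⟨i, j⟩, rfl⟩
    simp only [Submodule.comap_coe, Set.mem_preimage, hS2]
    exact Submodule.sum_mem _ fun p _ ↦ Submodule.sum_mem _ fun q _ ↦ C.smul_mem _ (hmem p q)
  have hcoalg : ∀ x ∈ C, Coalgebra.comul x ∈ LinearMap.range (map C.subtype C.subtype) := by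
    change C ≤ (LinearMap.range (map C.subtype C.subtype)).comap Coalgebra.comul
    refine Submodule.span_le.2 ?_
    rintro _ ⟨⟨i, j⟩, rfl⟩
    simp only [Submodule.comap_coe, Set.mem_preimage, hc.comul_apply]
    exact Submodule.sum_mem _ fun p _ ↦ ⟨⟨_, hmem i p⟩ ⊗ₜ ⟨_, hmem p j⟩, by simp⟩
  have hfin : FiniteDimensional k C := .of_basis e
  have hS2e (x : n × n) : S2.restrict hstable (e x) =
      ∑ y : n × n, (U x.1 y.1 * V y.2 x.2) • e y := by
    apply Subtype.ext
    simp [he, hS2, Fintype.sum_prod_type]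
  have h := hpi C hfin hcoalg hstable
  rw [LinearMap.trace_eq_matrix_trace k e, Module.finrank_eq_card_basis e] at h
  have hdiag (x : n × n) : LinearMap.toMatrix e e (S2.restrict hstable) x x =
      U x.1 x.1 * V x.2 x.2 := by
    rw [LinearMap.toMatrix_apply, hS2e]
    simp [Finsupp.single_apply]
  calc U.trace ^ 2 = U.trace * V.trace := by rw [htr, sq]
    _ = ∑ x : n × n, U x.1 x.1 * V x.2 x.2 := by
        simp [Matrix.trace, Fintype.sum_prod_type, Finset.sum_mul_sum]
    _ = (LinearMap.toMatrix e e (S2.restrict hstable)).trace := by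
        simp only [Matrix.trace, Matrix.diag_apply, hdiag]
    _ = (Fintype.card n : k) ^ 2 := by
        rw [h]
        simp [sq]

section

/-- For a pseudoinvolutive cotriangular Hopf algebra `(A, R)` with Drinfeld
element `u` and a simple finite-dimensional right `A`-comodule `X`, either `tr(u|_X) = dim X`
or `tr(u|_X) = -dim X`. -/
theorem statement1 {k A : Type u} [Field k] [IsAlgClosed k] [CharZero k]
    [Ring A] [HopfAlgebra k A]
    (R : A ⊗[k] A →ₗ[k] k) (hR : IsCT (mul' k A) R)
    (hpi : Pseudoinvolutive k A)
    (X : Type u) [AddCommGroup X] [Module k X] [FiniteDimensional k X] [Nontrivial X]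
    (ρ : X →ₗ[k] X ⊗[k] A) (hρ : IsComod X ρ)
    (hsimple : ∀ W : Submodule k X, IsSubcomod ρ W → W = ⊥ ∨ W = ⊤) :
    trace k X (coact ρ (drinfeld R)) = (Module.finrank k X : k) ∨
      trace k X (coact ρ (drinfeld R)) = -(Module.finrank k X : k) := by
  let b := Module.finBasis k X
  have h := (hρ.isMultiplicative b).trace_drinfeld_sq hR hpi
    (linearIndependent_coeffMatrix hρ hsimple b)
  rw [← toMatrix_coact, ← LinearMap.trace_eq_matrix_trace, Fintype.card_fin] at h
  exact sq_eq_sq_iff_eq_or_eq_neg.1 h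

end

end
end
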